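/- Assume the Framework with n := |P| ≤ m := |Q| < ∞, and assume moreover that the restriction α|Γ_p is ergodic for every p ∈ P. Then every restriction β|Λ_q (q ∈ Q) is also ergodic, n = m, and there is a bijection θ : P → Q such that for every p ∈ P the actions α|Γ_p and β|Λ_{θ(p)} are stably orbit equivalent. -/

import Mathlib

open MeasureTheory

/-- A countable Borel equivalence relation on `X`, defined on a Borel domain `dom`:
it is Borel as a subset of `X × X`, is an equivalence relation on `dom`, and has
countable classes. -/
structure CBER (X : Type) [MeasurableSpace X] where
  dom : Set X
  dom_meas : MeasurableSet dom
  rel : X → X → Prop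
  rel_meas : MeasurableSet {p : X × X | rel p.1 p.2}
  rel_dom : ∀ {x y : X}, rel x y → x ∈ dom ∧ y ∈ dom
  refl : ∀ x ∈ dom, rel x x
  symm : ∀ {x y : X}, rel x y → rel y x
  trans : ∀ {x y z : X}, rel x y → rel y z → rel x z
  countable_classes : ∀ x : X, {y | rel x y}.Countable

/-- The class of `x`. -/
def CBER.cls {X : Type} [MeasurableSpace X] (R : CBER X) (x : X) : Set X := {y | R.rel x y}

/-- The `R`-saturation of a set `A`: the union of the `R`-classes meeting `A`. -/
def CBER.sat {X : Type} [MeasurableSpace X] (R : CBER X) (A : Set X) : Set X :=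
  {y | ∃ x ∈ A, R.rel x y}

/-- A complete section: a Borel subset of the domain meeting every class. -/
def CBER.IsCompleteSection {X : Type} [MeasurableSpace X] (R : CBER X) (A : Set X) : Prop :=
  MeasurableSet A ∧ A ⊆ R.dom ∧ ∀ x ∈ R.dom, ∃ y ∈ A, R.rel x y

/-- A smooth CBER: one admitting a Borel fundamental domain (a Borel set meeting
every class exactly once). -/
def CBER.Smooth {X : Type} [MeasurableSpace X] (R : CBER X) : Prop :=
  ∃ D : Set X, MeasurableSet D ∧ D ⊆ R.dom ∧ ∀ x ∈ R.dom, ∃! y, y ∈ D ∧ R.rel x y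

/-- Smoothness of the restriction `R|A`. -/
def CBER.SmoothOn {X : Type} [MeasurableSpace X] (R : CBER X) (A : Set X) : Prop :=
  ∃ D : Set X, MeasurableSet D ∧ D ⊆ A ∧ ∀ x ∈ R.dom ∩ A, ∃! y, y ∈ D ∧ R.rel x y

/-- All classes are finite. -/
def CBER.FiniteClasses {X : Type} [MeasurableSpace X] (R : CBER X) : Prop :=
  ∀ x ∈ R.dom, (R.cls x).Finite

/-- Aperiodic: all classes are infinite (on the domain). -/
def CBER.Aperiodic {X : Type} [MeasurableSpace X] (R : CBER X) : Prop :=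
  ∀ x ∈ R.dom, (R.cls x).Infinite

/-- Trivial: all classes are singletons. -/
def CBER.TrivialClasses {X : Type} [MeasurableSpace X] (R : CBER X) : Prop :=
  ∀ x y, R.rel x y → x = y

/-- The restriction `R|U` of `R` to a Borel set `U`. -/
def CBER.restrict {X : Type} [MeasurableSpace X] (R : CBER X) (U : Set X)
    (hU : MeasurableSet U) : CBER X where
  dom := R.dom ∩ U
  dom_meas := R.dom_meas.inter hU
  rel x y := R.rel x y ∧ x ∈ U ∧ y ∈ U
  rel_meas := by
    have h : {p : X × X | R.rel p.1 p.2 ∧ p.1 ∈ U ∧ p.2 ∈ U} =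
        {p : X × X | R.rel p.1 p.2} ∩ (Prod.fst ⁻¹' U ∩ Prod.snd ⁻¹' U) := by
      ext p
      simp only [Set.mem_setOf_eq, Set.mem_inter_iff, Set.mem_preimage, and_assoc]
    rw [h]
    exact R.rel_meas.inter ((measurable_fst hU).inter (measurable_snd hU))
  rel_dom := fun h => ⟨⟨(R.rel_dom h.1).1, h.2.1⟩, ⟨(R.rel_dom h.1).2, h.2.2⟩⟩
  refl := fun x hx => ⟨R.refl x hx.1, hx.2, hx.2⟩
  symm := fun h => ⟨R.symm h.1, h.2.2, h.2.1⟩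
  trans := fun h h' => ⟨R.trans h.1 h'.1, h.2.1, h'.2.2⟩
  countable_classes := fun x =>
    Set.Countable.mono (fun y hy => hy.1) (R.countable_classes x)

/-- `S` is a subrelation of `R`. -/
def CBER.IsSubrelOf {X : Type} [MeasurableSpace X] (S R : CBER X) : Prop :=
  S.dom ⊆ R.dom ∧ ∀ x y, S.rel x y → R.rel x y

/-- A partial Borel isomorphism between Borel subsets `src` and `tgt` of `X`. -/
structure PBI (X : Type) [MeasurableSpace X] where
  src : Set X
  tgt : Set X
  src_meas : MeasurableSet src
  tgt_meas : MeasurableSet tgt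
  toFun : X → X
  invFun : X → X
  meas_toFun : Measurable toFun
  meas_invFun : Measurable invFun
  mapsTo : Set.MapsTo toFun src tgt
  mapsTo_inv : Set.MapsTo invFun tgt src
  left_inv : ∀ x ∈ src, invFun (toFun x) = x
  right_inv : ∀ y ∈ tgt, toFun (invFun y) = y

/-- Membership in the full pseudogroup `[[R]]`: a partial Borel isomorphism whose
graph is contained in `R`. -/
def CBER.InPseudogroup {X : Type} [MeasurableSpace X] (R : CBER X) (φ : PBI X) : Prop :=
  φ.src ⊆ R.dom ∧ ∀ x ∈ φ.src, R.rel x (φ.toFun x)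

/-- Two subrelations `S₁`, `S₂` of `R` are inner conjugate in `R` if some element of the
full pseudogroup of `R` with domain `D(S₂)` and target `D(S₁)` conjugates one to the other. -/
def InnerConjugate {X : Type} [MeasurableSpace X] (R S₁ S₂ : CBER X) : Prop :=
  ∃ φ : PBI X, R.InPseudogroup φ ∧ φ.src = S₂.dom ∧ φ.tgt = S₁.dom ∧
    ∀ x ∈ φ.src, ∀ y ∈ φ.src, (S₂.rel x y ↔ S₁.rel (φ.toFun x) (φ.toFun y))

/-- `R` preserves the measure `μ`: every element of its full pseudogroup preserves `μ`. -/
def CBER.IsPMP {X : Type} [MeasurableSpace X] (R : CBER X) (μ : Measure X) : Prop :=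
  ∀ φ : PBI X, R.InPseudogroup φ → ∀ A : Set X, A ⊆ φ.src → MeasurableSet A →
    μ (φ.toFun '' A) = μ A

/-- Free independence of a family of equivalence relations: any cycle alternating
nontrivially among the factors must have two consecutive steps in the same factor. -/
def FreelyIndep {X : Type} [MeasurableSpace X] {ι : Type} (Rf : ι → CBER X) : Prop :=
  ∀ (n : ℕ) (x : ℕ → X) (i : ℕ → ι), 2 ≤ n → x n = x 0 →
    (∀ j < n, x j ≠ x (j + 1)) → (∀ j < n, (Rf (i j)).rel (x j) (x (j + 1))) →
    ∃ j, j + 1 < n ∧ i j = i (j + 1)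

/-- `R` is the free product of the family `Rf`: the family is freely independent and `R`
is the smallest equivalence relation on the union of the domains containing every `Rf i`. -/
def IsFreeProduct {X : Type} [MeasurableSpace X] {ι : Type} (R : CBER X)
    (Rf : ι → CBER X) : Prop :=
  FreelyIndep Rf ∧ R.dom = (⋃ i, (Rf i).dom) ∧
    ∀ x y, R.rel x y ↔
      (x ∈ R.dom ∧ Relation.EqvGen (fun a b => ∃ i, (Rf i).rel a b) x y)

/-- The partition `U = ⊔ⱼ Uⱼ` trivializes the free product decomposition `R = *ⱼ Rf j`:
`U` is a complete section for `R`, the partition is `R|U`-invariant, and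
`R|Uⱼ = (Rf j)|Uⱼ` for every `j`. -/
def Trivializes {X : Type} [MeasurableSpace X] {ι : Type}
    (R : CBER X) (Rf : ι → CBER X) (U : ι → Set X) : Prop :=
  (∀ j, MeasurableSet (U j)) ∧ (∀ j, U j ⊆ R.dom) ∧
  Pairwise (Function.onFun Disjoint U) ∧
  (∀ x ∈ R.dom, ∃ y ∈ ⋃ j, U j, R.rel x y) ∧
  (∀ i j : ι, ∀ x ∈ U i, ∀ y ∈ U j, R.rel x y → i = j) ∧
  (∀ j, ∀ x ∈ U j, ∀ y ∈ U j, (R.rel x y ↔ (Rf j).rel x y))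

/-- A free product decomposition is inessential if it admits a trivialization. -/
def Inessential {X : Type} [MeasurableSpace X] {ι : Type}
    (R : CBER X) (Rf : ι → CBER X) : Prop :=
  ∃ U : ι → Set X, Trivializes R Rf U

/-- Freely indecomposable (Borel context): every free product decomposition is inessential. -/
def FreelyIndecomposable {X : Type} [MeasurableSpace X] (R : CBER X) : Prop :=
  ∀ (ι : Type) (_ : Countable ι) (Rf : ι → CBER X), IsFreeProduct R Rf → Inessential R Rf

/-- Inessential decomposition in the measured context: a trivialization up to `μ`-null sets. -/
def InessentialMod {X : Type} [MeasurableSpace X] (μ : Measure X) {ι : Type}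
    (R : CBER X) (Rf : ι → CBER X) : Prop :=
  ∃ (U : ι → Set X) (C : Set X),
    (∀ j, MeasurableSet (U j)) ∧ (∀ j, U j ⊆ R.dom) ∧
    Pairwise (Function.onFun Disjoint U) ∧
    MeasurableSet C ∧ μ Cᶜ = 0 ∧
    (∀ x ∈ R.dom ∩ C, ∃ y ∈ ⋃ j, U j, R.rel x y) ∧
    (∀ i j : ι, ∀ x ∈ U i ∩ C, ∀ y ∈ U j ∩ C, R.rel x y → i = j) ∧
    (∀ j, ∀ x ∈ U j ∩ C, ∀ y ∈ U j ∩ C, (R.rel x y ↔ (Rf j).rel x y))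

/-- Freely indecomposable (measured context): every free product decomposition is
inessential up to `μ`-null sets. -/
def FreelyIndecomposableMod {X : Type} [MeasurableSpace X] (μ : Measure X)
    (R : CBER X) : Prop :=
  ∀ (ι : Type) (_ : Countable ι) (Rf : ι → CBER X), IsFreeProduct R Rf →
    InessentialMod μ R Rf

/-- One step of a word in a graphing: apply `φ` (if `e = true`) or `φ⁻¹` (if `e = false`). -/
def PBIStep {X : Type} [MeasurableSpace X] (φ : PBI X) : Bool → X → X → Prop
  | true, a, b => a ∈ φ.src ∧ φ.toFun a = b
  | false, a, b => a ∈ φ.tgt ∧ φ.invFun a = b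

/-- A treeing: any cyclic word in the generators and their inverses admits a reduction. -/
def IsTreeing {X : Type} [MeasurableSpace X] {ι : Type} (Φ : ι → PBI X) : Prop :=
  ∀ (n : ℕ) (i : ℕ → ι) (ε : ℕ → Bool) (x : ℕ → X),
    0 < n → x n = x 0 → (∀ j < n, PBIStep (Φ (i j)) (ε j) (x j) (x (j + 1))) →
    ∃ j, j + 1 < n ∧ i j = i (j + 1) ∧ ε j ≠ ε (j + 1)

/-- The graphing `Φ` generates `R`: `R` is the smallest equivalence relation on the union of
the sources and targets containing the graphs of the `Φ i`. -/
def GeneratesCBER {X : Type} [MeasurableSpace X] {ι : Type} (Φ : ι → PBI X)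
    (R : CBER X) : Prop :=
  R.dom = (⋃ i, ((Φ i).src ∪ (Φ i).tgt)) ∧ (∀ i, R.InPseudogroup (Φ i)) ∧
    ∀ x y, R.rel x y ↔ (x ∈ R.dom ∧
      Relation.EqvGen (fun a b => ∃ i, a ∈ (Φ i).src ∧ (Φ i).toFun a = b) x y)

/-- Treeable: generated by some (countable) treeing. -/
def CBER.Treeable {X : Type} [MeasurableSpace X] (R : CBER X) : Prop :=
  ∃ Φ : ℕ → PBI X, IsTreeing Φ ∧ GeneratesCBER Φ R

/-- Hyperfinite: increasing union of finite Borel subrelations. -/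
def CBER.Hyperfinite {X : Type} [MeasurableSpace X] (R : CBER X) : Prop :=
  ∃ S : ℕ → CBER X, (∀ n, (S n).IsSubrelOf R) ∧ (∀ n, (S n).FiniteClasses) ∧
    (∀ n, (S n).dom = R.dom) ∧ (∀ n, ∀ x y, (S n).rel x y → (S (n + 1)).rel x y) ∧
    ∀ x y, R.rel x y → ∃ n, (S n).rel x y

/-- Ergodicity of a measured CBER: every invariant Borel set is null or conull. -/
def ErgodicCBER {X : Type} [MeasurableSpace X] (R : CBER X) (μ : Measure X) : Prop :=
  ∀ A : Set X, MeasurableSet A → (∀ x ∈ A, ∀ y, R.rel x y → y ∈ A) →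
    μ A = 0 ∨ μ Aᶜ = 0

/-- A stable orbit equivalence between measured CBERs: a Borel isomorphism between
complete sections (mod null sets), sending the normalized measure to the normalized
measure, and preserving the relations a.e. -/
structure SOEquiv {X Y : Type} [MeasurableSpace X] [MeasurableSpace Y]
    (R : CBER X) (μ : Measure X) (S : CBER Y) (ν : Measure Y) where
  A : Set X
  B : Set Y
  toFun : X → Y
  invFun : Y → X
  measA : MeasurableSet A
  measB : MeasurableSet B
  A_sub : A ⊆ R.dom
  B_sub : B ⊆ S.dom
  A_pos : 0 < μ A
  B_pos : 0 < ν B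
  A_section : ∀ᵐ x ∂μ, x ∈ R.dom → ∃ y ∈ A, R.rel x y
  B_section : ∀ᵐ y ∂ν, y ∈ S.dom → ∃ z ∈ B, S.rel y z
  meas_toFun : Measurable toFun
  meas_invFun : Measurable invFun
  mapsTo : Set.MapsTo toFun A B
  mapsTo_inv : Set.MapsTo invFun B A
  left_inv : ∀ x ∈ A, invFun (toFun x) = x
  right_inv : ∀ y ∈ B, toFun (invFun y) = y
  measure_eq : ∀ E : Set X, E ⊆ A → MeasurableSet E →
    (μ A)⁻¹ * μ E = (ν B)⁻¹ * ν (toFun '' E)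
  rel_iff : ∃ C : Set X, MeasurableSet C ∧ μ (A \ C) = 0 ∧
    ∀ x ∈ A ∩ C, ∀ y ∈ A ∩ C, (R.rel x y ↔ S.rel (toFun x) (toFun y))

/-- Stable orbit equivalence. -/
def SOE {X Y : Type} [MeasurableSpace X] [MeasurableSpace Y]
    (R : CBER X) (μ : Measure X) (S : CBER Y) (ν : Measure Y) : Prop :=
  Nonempty (SOEquiv R μ S ν)

/-- Orbit equivalence: a stable orbit equivalence where one can take the complete
sections to be the full spaces. -/
def OE {X Y : Type} [MeasurableSpace X] [MeasurableSpace Y]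
    (R : CBER X) (μ : Measure X) (S : CBER Y) (ν : Measure Y) : Prop :=
  ∃ E : SOEquiv R μ S ν, E.A = Set.univ ∧ E.B = Set.univ

/-- A probability measure preserving action of a group `G` on a measured space. -/
structure PMPAction (G : Type) [Group G] (X : Type) [MeasurableSpace X]
    (μ : Measure X) where
  act : G → X → X
  act_one : ∀ x, act 1 x = x
  act_mul : ∀ g h x, act (g * h) x = act g (act h x)
  measurePreserving : ∀ g, MeasurePreserving (act g) μ μ

/-- Essential freeness: a.e. point has trivial stabilizer. -/
def PMPAction.IsFree {G X : Type} [Group G] [MeasurableSpace X] {μ : Measure X}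
    (α : PMPAction G X μ) : Prop :=
  ∀ᵐ x ∂μ, ∀ g : G, α.act g x = x → g = 1

/-- `R` is the orbit equivalence relation of the action `α` restricted to the subgroup `H`. -/
def IsOrbitRel {G X : Type} [Group G] [MeasurableSpace X] {μ : Measure X}
    (α : PMPAction G X μ) (H : Subgroup G) (R : CBER X) : Prop :=
  R.dom = Set.univ ∧ ∀ x y, (R.rel x y ↔ ∃ g ∈ H, α.act g x = y)

/-- A countable group is measurably freely indecomposable (MFI) if the orbit equivalence
relation of every free p.m.p. action of it on a standard probability space is freely
indecomposable. -/
def MFI (G : Type) [Group G] [Countable G] : Prop :=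
  ∀ (X : Type) [MeasurableSpace X] [StandardBorelSpace X]
    (μ : Measure X) [IsProbabilityMeasure μ]
    (α : PMPAction G X μ) (R : CBER X),
    α.IsFree → IsOrbitRel α ⊤ R → FreelyIndecomposableMod μ R

/-- `G` is the internal free product of the family of subgroups `H`. -/
def IsFreeProductOf (G : Type) [Group G] {ι : Type} (H : ι → Subgroup G) : Prop :=
  Function.Bijective (Monoid.CoprodI.lift fun i => (H i).subtype)

/-- A Borel fundamental domain for an action, of the coupling kind: meets a.e. orbit,
and meets each orbit at most once mod null. -/
def IsFundamentalDomainFor {G : Type} [Group G] {Ω : Type} [MeasurableSpace Ω]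
    (ν : Measure Ω) (a : G → Ω → Ω) (D : Set Ω) : Prop :=
  MeasurableSet D ∧ (∀ᵐ x ∂ν, ∃ g : G, a g x ∈ D) ∧
    ∀ g : G, g ≠ 1 → ν (D ∩ a g ⁻¹' D) = 0

/-- A measure equivalence coupling between `G` and `H`: a standard σ-finite measure space
with commuting measure-preserving essentially free actions of `G` and `H`, each admitting
a Borel fundamental domain of finite positive measure. -/
structure MECoupling (G : Type) [Group G] (H : Type) [Group H] where
  (Ω : Type)
  [mΩ : MeasurableSpace Ω]
  [sbΩ : StandardBorelSpace Ω]
  (ν : Measure Ω)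
  sigmaFinite : SigmaFinite ν
  aG : G → Ω → Ω
  aH : H → Ω → Ω
  DG : Set Ω
  DH : Set Ω
  aG_one : ∀ x, aG 1 x = x
  aG_mul : ∀ g g' x, aG (g * g') x = aG g (aG g' x)
  aH_one : ∀ x, aH 1 x = x
  aH_mul : ∀ h h' x, aH (h * h') x = aH h (aH h' x)
  comm : ∀ g h x, aG g (aH h x) = aH h (aG g x)
  mp_aG : ∀ g, MeasurePreserving (aG g) ν ν
  mp_aH : ∀ h, MeasurePreserving (aH h) ν ν
  free_aG : ∀ᵐ x ∂ν, ∀ g, aG g x = x → g = 1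
  free_aH : ∀ᵐ x ∂ν, ∀ h, aH h x = x → h = 1
  fund_DG : IsFundamentalDomainFor ν aG DG
  fund_DH : IsFundamentalDomainFor ν aH DH
  DG_pos : 0 < ν DG
  DG_fin : ν DG < ⊤
  DH_pos : 0 < ν DH
  DH_fin : ν DH < ⊤

/-- The generalized index (compression constant) of a measure equivalence coupling. -/
noncomputable def MECoupling.index {G : Type} [Group G] {H : Type} [Group H]
    (c : MECoupling G H) : ENNReal :=
  c.ν c.DH / c.ν c.DG

/-- Measure equivalence of countable groups. -/
def MeasureEquivalent (G : Type) [Group G] (H : Type) [Group H] : Prop :=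
  Nonempty (MECoupling G H)

/-- Measure equivalence with a prescribed generalized index. -/
def MEwithIndex (G : Type) [Group G] (H : Type) [Group H] (κ : ENNReal) : Prop :=
  ∃ c : MECoupling G H, c.index = κ

theorem measurable_sInf_nat {α : Type*} [MeasurableSpace α] {p : ℕ → α → Prop}
    (hp : ∀ n, Measurable (p n)) : Measurable fun x => sInf {n | p n x} := by
  classical
  let q : α → ℕ → Prop := fun x n => p n x ∨ ∀ k, ¬ p k x
  have hq : ∀ n, MeasurableSet {x | q x n} := fun n =>
    measurableSet_setOfPred.2 (.or (hp n) (.forall fun k => (hp k).not))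
  have hex : ∀ x, ∃ n, q x n := fun x => by
    by_cases h : ∃ n, p n x
    · exact h.imp fun n hn => Or.inl hn
    · exact ⟨0, Or.inr (not_exists.mp h)⟩
  convert measurable_find hex hq using 2 with x
  by_cases h : ∃ n, p n x
  · have h' : {n | p n x}.Nonempty := h
    rw [Nat.sInf_def h']
    refine le_antisymm (Nat.find_min' _ ?_) (Nat.find_min' _ (Or.inl (Nat.find_spec h')))
    exact (Nat.find_spec (hex x)).resolve_right fun hn => hn _ h.choose_spec
  · have h' : {n | p n x} = ∅ := Set.eq_empty_of_forall_notMem fun n hn => h ⟨n, hn⟩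
    rw [h', Nat.sInf_empty]
    exact (Nat.le_zero.mp (Nat.find_min' _ (Or.inr (not_exists.mp h)))).symm

theorem Measurable.select_nat {α β : Type*} [MeasurableSpace α] [MeasurableSpace β]
    {F : ℕ → α → β} (hF : ∀ n, Measurable (F n)) {k : α → ℕ} (hk : Measurable k) :
    Measurable fun x => F (k x) x :=
  (measurable_from_prod_countable_right (f := fun q : ℕ × α => F q.1 q.2) hF).comp
    (hk.prodMk measurable_id)

/-- A family of relations is freely independent as soon as the universal cocycles of its members
extend to a common cocycle on every class. -/
theorem freelyIndep_of_cocycle {X : Type} [MeasurableSpace X] {J : Type} (Rf : J → CBER X)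
    (S : X → X → Prop) (hrefl : ∀ x, S x x) (htrans : ∀ x y z, S x y → S y z → S x z)
    (hS : ∀ j x y, (Rf j).rel x y → S x y)
    (h : ∀ x₀, ∃ c : X → X → Monoid.CoprodI (fun _ : J => FreeGroup X),
      (∀ x y z, S x₀ x → S x₀ y → S x₀ z → c x z = c x y * c y z) ∧
      ∀ j x y, S x₀ x → (Rf j).rel x y → c x y =
        Monoid.CoprodI.of (M := fun _ : J => FreeGroup X) (i := j)
          ((FreeGroup.of x)⁻¹ * FreeGroup.of y)) :
    FreelyIndep Rf := by
  classical
  intro n x i hn hcyc hne hrel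
  by_contra hcon
  push Not at hcon
  obtain ⟨c, hc, hcR⟩ := h (x 0)
  have hSx : ∀ j ≤ n, S (x 0) (x j) := by
    intro j
    induction j with
    | zero => intro _; exact hrefl _
    | succ j ih => intro hj; exact htrans _ _ _ (ih (by omega)) (hS _ _ _ (hrel j (by omega)))
  let L : ℕ → Σ _ : J, FreeGroup X := fun j => ⟨i j, (FreeGroup.of (x j))⁻¹ * FreeGroup.of (x (j + 1))⟩
  let w : Monoid.CoprodI.Word (fun _ : J => FreeGroup X) :=
    { toList := (List.range n).map L
      ne_one := by
        intro l hl
        obtain ⟨j, hj, rfl⟩ := List.mem_map.mp hl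
        intro h1
        rw [inv_mul_eq_one] at h1
        exact hne j (List.mem_range.mp hj) (FreeGroup.of_injective h1)
      chain_ne := by
        rw [List.isChain_iff_getElem]
        intro j hj
        simp only [List.length_map, List.length_range] at hj
        simpa [L] using hcon j hj }
  have hone : ∀ y, S (x 0) y → c y y = 1 := fun y hy => by
    have := hc y y y hy hy hy
    simpa using this
  have hprod : ∀ j ≤ n, c (x 0) (x j) =
      (((List.range j).map L).map fun l => Monoid.CoprodI.of (M := fun _ : J => FreeGroup X)
        (i := l.1) l.2).prod := by
    intro j
    induction j with
    | zero => intro _; simpa using hone _ (hrefl _)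
    | succ j ih =>
      intro hj
      rw [List.range_succ, List.map_append, List.map_append, List.prod_append, ← ih (by omega),
        hc _ (x j) _ (hrefl _) (hSx j (by omega)) (hSx _ hj),
        hcR (i j) _ _ (hSx j (by omega)) (hrel j (by omega))]
      simp [L]
  have h1 : w.prod = 1 := by
    have := hprod n le_rfl
    rw [hcyc, hone _ (hrefl _)] at this
    exact this.symm
  have h2 : w = Monoid.CoprodI.Word.empty :=
    Monoid.CoprodI.Word.equiv.symm.injective (by
      change w.prod = Monoid.CoprodI.Word.empty.prod
      rw [h1, Monoid.CoprodI.Word.prod_empty])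
  have h3 : (List.range n).map L = [] := congrArg Monoid.CoprodI.Word.toList h2
  simp at h3
  omega

/-- The equivalence relation generated by a family of relations. -/
def GenBy {Y ι : Type} (T : ι → Y → Y → Prop) : Y → Y → Prop :=
  Relation.EqvGen fun y y' => ∃ i, T i y y'

theorem GenBy.of {Y ι : Type} {T : ι → Y → Y → Prop} {i : ι} {y y' : Y} (h : T i y y') :
    GenBy T y y' :=
  Relation.EqvGen.rel _ _ ⟨i, h⟩

theorem GenBy.rfl {Y ι : Type} {T : ι → Y → Y → Prop} {y : Y} : GenBy T y y :=
  Relation.EqvGen.refl _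

theorem GenBy.symm {Y ι : Type} {T : ι → Y → Y → Prop} {y y' : Y} (h : GenBy T y y') :
    GenBy T y' y :=
  Relation.EqvGen.symm _ _ h

theorem GenBy.trans {Y ι : Type} {T : ι → Y → Y → Prop} {y y' y'' : Y} (h : GenBy T y y')
    (h' : GenBy T y' y'') : GenBy T y y'' :=
  Relation.EqvGen.trans _ _ _ h h'

/-- A cocycle on a relation `T` with values in a group. -/
def IsCocycleOn {Y K : Type} [Group K] (T : Y → Y → Prop) (c : Y → Y → K) : Prop :=
  ∀ x y z, T x y → T y z → c x z = c x y * c y z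

theorem IsCocycleOn.self {Y K : Type} [Group K] {T : Y → Y → Prop} {c : Y → Y → K}
    (hc : IsCocycleOn T c) {y : Y} (hy : T y y) : c y y = 1 := by
  simpa using hc y y y hy hy

/-- A countable Borel equivalence relation `S` on `X` mapped by `f` into the classes of the
relation generated by a countable family `T` of relations on `Y` which is freely independent,
in the sense that cocycles on the `T i` extend to the generated relation. -/
structure TreeAction (X Y ι : Type) [MeasurableSpace X] [MeasurableSpace Y] where
  S : CBER X
  dom_univ : S.dom = Set.univ
  a : ℕ → X → X
  a_meas : ∀ n, Measurable (a n)
  a_inj : ∀ n, Function.Injective (a n)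
  S_iff : ∀ x y, S.rel x y ↔ ∃ n, a n x = y
  sep : ℕ → Set X
  sep_meas : ∀ n, MeasurableSet (sep n)
  sep_spec : ∀ x y, x ≠ y → ∃ n, x ∈ sep n ∧ y ∉ sep n
  X₀ : Set X
  X₀_meas : MeasurableSet X₀
  X₀_inv : ∀ x y, S.rel x y → x ∈ X₀ → y ∈ X₀
  f : X → Y
  f_meas : Measurable f
  κ : X → ℕ
  κ_meas : Measurable κ
  f_inj : ∀ x y, x ∈ X₀ → S.rel x y → f x = f y → κ x = κ y → x = y
  b : ℕ → Y → Y
  b_meas : ∀ n, Measurable (b n)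
  T : ι → Y → Y → Prop
  T_meas : ∀ i, Measurable fun p : Y × Y => T i p.1 p.2
  T_equiv : ∀ i, Equivalence (T i)
  code : ℕ → ι × ℕ
  code_surj : Function.Surjective code
  b_of_gen : ∀ y y', GenBy T y y' → ∃ n, b n y = y'
  gen_b : ∀ x ∈ X₀, ∀ y, GenBy T (f x) y → ∀ n, GenBy T y (b n y)
  conn : ∀ x y, x ∈ X₀ → S.rel x y → GenBy T (f x) (f y)
  ext : ∀ (K : Type) [Group K] (C : ι → Y → Y → K), (∀ i, IsCocycleOn (T i) (C i)) →
    ∀ x ∈ X₀, ∃ c : Y → Y → K,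
      (∀ y y' y'', GenBy T (f x) y → GenBy T (f x) y' → GenBy T (f x) y'' →
        c y y'' = c y y' * c y' y'') ∧
      ∀ i y y', GenBy T (f x) y → T i y y' → c y y' = C i y y'

namespace TreeAction

variable {X Y ι : Type} [MeasurableSpace X] [MeasurableSpace Y] (D : TreeAction X Y ι)

open Classical in
/-- The move of a point of `Y` with a given code. -/
noncomputable def step (k : ℕ) (y : Y) : Y :=
  if D.T (D.code k).1 y (D.b (D.code k).2 y) then D.b (D.code k).2 y else y

/-- `y` reaches the image of the class of `x` in `n` moves. -/
def Near : ℕ → X → Y → Prop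
  | 0, x, y => ∃ n, D.f (D.a n x) = y
  | n + 1, x, y => ∃ k, Near n x (D.step k y)

/-- The distance from `y` to the image of the class of `x`. -/
noncomputable def dist (x : X) (y : Y) : ℕ := sInf {n | D.Near n x y}

/-- The first move from `y` towards the image of the class of `x`. -/
noncomputable def move (x : X) (y : Y) : ℕ := sInf {k | D.Near (D.dist x y - 1) x (D.step k y)}

/-- The point reached from `y` by the first move towards the image of the class of `x`. -/
noncomputable def parent (x : X) (y : Y) : Y := D.step (D.move x y) y

/-- The index of the relation along which the first move is made. -/
noncomputable def label (x : X) (y : Y) : ι := (D.code (D.move x y)).1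

/-- The least value of `κ` on the points over `y` in the class of `x`. -/
noncomputable def lvl (x : X) (y : Y) : ℕ :=
  sInf {n | ∃ l, D.f (D.a l x) = y ∧ D.κ (D.a l x) = n}

/-- The preferred point over `y` in the class of `x`. -/
noncomputable def lift (x : X) (y : Y) : X :=
  D.a (sInf {l | D.f (D.a l x) = y ∧ D.κ (D.a l x) = D.lvl x y}) x

/-- The point of the class of `x` reached from `y` after `n` moves. -/
noncomputable def rootAux : ℕ → X → Y → X
  | 0, x, y => D.lift x y
  | n + 1, x, y => rootAux n x (D.parent x y)

/-- The point of the class of `x` to which `y` is attached. -/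
noncomputable def root (x : X) (y : Y) : X := D.rootAux (D.dist x y) x y

/-- The address of `y` relative to its root. -/
noncomputable def addr (x : X) (y : Y) : ℕ := sInf {n | D.b n (D.f (D.root x y)) = y}

/-- `y` does not move inside its `T i`-class. -/
def Stays (i : ι) (x : X) (y : Y) : Prop := D.dist x y = 0 ∨ D.label x y ≠ i

/-- The least address of a staying point in the `T i`-class of `y`. -/
noncomputable def minAddr (i : ι) (x : X) (y : Y) : ℕ :=
  sInf {n | ∃ l, D.T i y (D.b l y) ∧ D.Stays i x (D.b l y) ∧ D.addr x (D.b l y) = n}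

/-- A staying point of least address in the `T i`-class of `y`. -/
noncomputable def anchor (i : ι) (x : X) (y : Y) : Y :=
  D.b (sInf {l | D.T i y (D.b l y) ∧ D.Stays i x (D.b l y) ∧
    D.addr x (D.b l y) = D.minAddr i x y}) y

/-- The point of address `n` relative to `z` is attached to `z` and stays in its `T i`-class. -/
def Holds (i : ι) (n : ℕ) (z : X) : Prop :=
  D.root z (D.b n (D.f z)) = z ∧ D.addr z (D.b n (D.f z)) = n ∧ D.Stays i z (D.b n (D.f z))

open Classical in
/-- The edges of the new decomposition: `none` joins a point to the preferred point with the same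
image, and `some (i, n)` joins a point which is not an anchor to an anchor. -/
noncomputable def edge : Option (ι × ℕ) → X → X
  | none, z => D.root z (D.f z)
  | some (i, n), z =>
      if D.Holds i n z ∧ D.minAddr i z (D.b n (D.f z)) ≠ n then
        D.root z (D.anchor i z (D.b n (D.f z))) else z

/-- The vertex relations of the new decomposition. -/
def VRel (i : ι) (n : ℕ) (z z' : X) : Prop :=
  (D.Holds i n z ∧ D.minAddr i z (D.b n (D.f z)) = n) ∧
  (D.Holds i n z' ∧ D.minAddr i z' (D.b n (D.f z')) = n) ∧
    D.T i (D.b n (D.f z)) (D.b n (D.f z'))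

/-- The least index of a map of the sequence `a` sending `z` to `z'`. -/
noncomputable def mapIdx (z z' : X) : ℕ := sInf {l | D.a l z = z'}

/-- The least index of a set of the sequence `sep` separating `z` from `z'`. -/
noncomputable def sepIdx (z z' : X) : ℕ := sInf {k | z ∈ D.sep k ∧ z' ∉ D.sep k}

/-- The oriented edges of a given type between separated points. -/
def ERel (t : Option (ι × ℕ)) (l k : ℕ) (z z' : X) : Prop :=
  D.edge t z = z' ∧ (D.mapIdx z z' = l ∧ D.sepIdx z z' = k) ∧
    D.a l z = z' ∧ z ∈ D.sep k ∧ z' ∉ D.sep k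

/-- The relations of the new decomposition. -/
def newRel : Option ((ι × ℕ) ⊕ (Option (ι × ℕ) × ℕ × ℕ)) → X → X → Prop
  | none, z, z' => z = z' ∨ (D.S.rel z z' ∧ z ∉ D.X₀)
  | some (.inl (i, n)), z, z' => z = z' ∨ (D.S.rel z z' ∧ z ∈ D.X₀ ∧ D.VRel i n z z')
  | some (.inr (t, l, k)), z, z' =>
      z = z' ∨ (D.S.rel z z' ∧ z ∈ D.X₀ ∧ (D.ERel t l k z z' ∨ D.ERel t l k z' z))

/-! ### Measurability -/

theorem measurable_step (k : ℕ) : Measurable (D.step k) := by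
  classical
  unfold step
  exact Measurable.ite (measurableSet_setOfPred.2
    ((D.T_meas _).comp (measurable_id.prodMk (D.b_meas _)))) (D.b_meas _) measurable_id

set_option linter.unusedSectionVars false

variable [StandardBorelSpace X] [StandardBorelSpace Y]

theorem measurable_near (n : ℕ) : Measurable fun p : X × Y => D.Near n p.1 p.2 := by
  induction n with
  | zero =>
    refine .exists fun n => Measurable.eq ?_ measurable_snd
    exact D.f_meas.comp ((D.a_meas n).comp measurable_fst)
  | succ n ih =>
    refine .exists fun k => ?_
    exact ih.comp (measurable_fst.prodMk ((D.measurable_step k).comp measurable_snd))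

theorem measurable_dist : Measurable fun p : X × Y => D.dist p.1 p.2 :=
  measurable_sInf_nat fun n => D.measurable_near n

theorem measurable_move : Measurable fun p : X × Y => D.move p.1 p.2 := by
  refine measurable_sInf_nat (p := fun k (p : X × Y) =>
    D.Near (D.dist p.1 p.2 - 1) p.1 (D.step k p.2)) fun k => ?_
  exact Measurable.select_nat (F := fun m (p : X × Y) => D.Near m p.1 (D.step k p.2))
    (fun m => (D.measurable_near m).comp
      (measurable_fst.prodMk ((D.measurable_step k).comp measurable_snd)))
    (k := fun p : X × Y => D.dist p.1 p.2 - 1)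
    ((measurable_of_countable fun m : ℕ => m - 1).comp D.measurable_dist)

theorem measurable_parent : Measurable fun p : X × Y => D.parent p.1 p.2 :=
  Measurable.select_nat (F := fun m (p : X × Y) => D.step m p.2)
    (fun m => (D.measurable_step m).comp measurable_snd) D.measurable_move

theorem measurable_label (i : ι) : Measurable fun p : X × Y => D.label p.1 p.2 = i :=
  (measurable_of_countable fun k => (D.code k).1 = i).comp D.measurable_move

theorem measurable_lvl : Measurable fun p : X × Y => D.lvl p.1 p.2 := by
  refine measurable_sInf_nat (p := fun n (p : X × Y) =>
    ∃ l, D.f (D.a l p.1) = p.2 ∧ D.κ (D.a l p.1) = n) fun n => .exists fun l => .and ?_ ?_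
  · exact Measurable.eq (D.f_meas.comp ((D.a_meas l).comp measurable_fst)) measurable_snd
  · exact Measurable.eq (D.κ_meas.comp ((D.a_meas l).comp measurable_fst)) measurable_const

theorem measurable_lift : Measurable fun p : X × Y => D.lift p.1 p.2 := by
  refine Measurable.select_nat (F := fun m (p : X × Y) => D.a m p.1)
    (fun m => (D.a_meas m).comp measurable_fst) (measurable_sInf_nat (p := fun l (p : X × Y) =>
      D.f (D.a l p.1) = p.2 ∧ D.κ (D.a l p.1) = D.lvl p.1 p.2) fun l => .and ?_ ?_)
  · exact Measurable.eq (D.f_meas.comp ((D.a_meas l).comp measurable_fst)) measurable_snd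
  · exact Measurable.eq (D.κ_meas.comp ((D.a_meas l).comp measurable_fst)) D.measurable_lvl

theorem measurable_rootAux (n : ℕ) : Measurable fun p : X × Y => D.rootAux n p.1 p.2 := by
  induction n with
  | zero => exact D.measurable_lift
  | succ n ih => exact ih.comp (measurable_fst.prodMk D.measurable_parent)

theorem measurable_root : Measurable fun p : X × Y => D.root p.1 p.2 :=
  Measurable.select_nat (F := fun m (p : X × Y) => D.rootAux m p.1 p.2)
    D.measurable_rootAux D.measurable_dist

theorem measurable_addr : Measurable fun p : X × Y => D.addr p.1 p.2 :=
  measurable_sInf_nat (p := fun n (p : X × Y) => D.b n (D.f (D.root p.1 p.2)) = p.2) fun n =>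
    Measurable.eq ((D.b_meas n).comp (D.f_meas.comp D.measurable_root)) measurable_snd

theorem measurable_stays (i : ι) : Measurable fun p : X × Y => D.Stays i p.1 p.2 :=
  .or (Measurable.eq D.measurable_dist measurable_const) (D.measurable_label i).not

theorem measurable_pair_b (l : ℕ) : Measurable fun p : X × Y => (p.1, D.b l p.2) :=
  measurable_fst.prodMk ((D.b_meas l).comp measurable_snd)

theorem measurable_T_b (i : ι) (l : ℕ) : Measurable fun p : X × Y => D.T i p.2 (D.b l p.2) :=
  (D.T_meas i).comp (measurable_snd.prodMk ((D.b_meas l).comp measurable_snd))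

theorem measurable_minAddr (i : ι) : Measurable fun p : X × Y => D.minAddr i p.1 p.2 :=
  measurable_sInf_nat (p := fun n (p : X × Y) => ∃ l, D.T i p.2 (D.b l p.2) ∧
    D.Stays i p.1 (D.b l p.2) ∧ D.addr p.1 (D.b l p.2) = n) fun _ => .exists fun l =>
    .and (D.measurable_T_b i l) (.and ((D.measurable_stays i).comp (D.measurable_pair_b l))
      (Measurable.eq (D.measurable_addr.comp (D.measurable_pair_b l)) measurable_const))

theorem measurable_anchor (i : ι) : Measurable fun p : X × Y => D.anchor i p.1 p.2 :=
  Measurable.select_nat (F := fun m (p : X × Y) => D.b m p.2)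
    (fun m => (D.b_meas m).comp measurable_snd)
    (measurable_sInf_nat (p := fun l (p : X × Y) => D.T i p.2 (D.b l p.2) ∧
      D.Stays i p.1 (D.b l p.2) ∧ D.addr p.1 (D.b l p.2) = D.minAddr i p.1 p.2) fun l =>
    .and (D.measurable_T_b i l) (.and ((D.measurable_stays i).comp (D.measurable_pair_b l))
      (Measurable.eq (D.measurable_addr.comp (D.measurable_pair_b l)) (D.measurable_minAddr i))))

theorem measurable_point (n : ℕ) : Measurable fun z : X => (z, D.b n (D.f z)) :=
  measurable_id.prodMk ((D.b_meas n).comp D.f_meas)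

theorem measurable_holds (i : ι) (n : ℕ) : Measurable fun z => D.Holds i n z :=
  .and (Measurable.eq (D.measurable_root.comp (D.measurable_point n)) measurable_id)
    (.and (Measurable.eq (D.measurable_addr.comp (D.measurable_point n)) measurable_const)
      ((D.measurable_stays i).comp (D.measurable_point n)))

theorem measurable_minAddr_eq (i : ι) (n : ℕ) :
    Measurable fun z => D.minAddr i z (D.b n (D.f z)) = n :=
  Measurable.eq ((D.measurable_minAddr i).comp (D.measurable_point n)) measurable_const

theorem measurable_edge (t : Option (ι × ℕ)) : Measurable (D.edge t) := by
  classical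
  match t with
  | none => exact D.measurable_root.comp (measurable_id.prodMk D.f_meas)
  | some (i, n) =>
    refine Measurable.ite (measurableSet_setOfPred.2 (.and (D.measurable_holds i n)
      (D.measurable_minAddr_eq i n).not)) ?_ measurable_id
    exact D.measurable_root.comp (measurable_id.prodMk
      ((D.measurable_anchor i).comp (D.measurable_point n)))

theorem measurable_a_eq (l : ℕ) : Measurable fun p : X × X => D.a l p.1 = p.2 :=
  Measurable.eq ((D.a_meas l).comp measurable_fst) measurable_snd

theorem measurable_sep (k : ℕ) : Measurable fun p : X × X => p.1 ∈ D.sep k ∧ p.2 ∉ D.sep k :=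
  .and ((D.sep_meas k).mem.comp measurable_fst) ((D.sep_meas k).mem.comp measurable_snd).not

theorem measurable_mapIdx : Measurable fun p : X × X => D.mapIdx p.1 p.2 :=
  measurable_sInf_nat D.measurable_a_eq

theorem measurable_sepIdx : Measurable fun p : X × X => D.sepIdx p.1 p.2 :=
  measurable_sInf_nat D.measurable_sep

theorem measurable_eRel (t : Option (ι × ℕ)) (l k : ℕ) :
    Measurable fun p : X × X => D.ERel t l k p.1 p.2 :=
  .and (Measurable.eq ((D.measurable_edge t).comp measurable_fst) measurable_snd)
    (.and (.and (Measurable.eq D.measurable_mapIdx measurable_const)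
        (Measurable.eq D.measurable_sepIdx measurable_const))
      (.and (D.measurable_a_eq l) (D.measurable_sep k)))

theorem measurable_newRel (j) : Measurable fun p : X × X => D.newRel j p.1 p.2 := by
  have hS : Measurable fun p : X × X => D.S.rel p.1 p.2 := measurableSet_setOfPred.1 D.S.rel_meas
  have hX : Measurable fun p : X × X => p.1 ∈ D.X₀ := D.X₀_meas.mem.comp measurable_fst
  have hE : Measurable fun p : X × X => p.1 = p.2 := Measurable.eq measurable_fst measurable_snd
  match j with
  | none => exact .or hE (.and hS hX.not)
  | some (.inl (i, n)) =>
    have h1 : Measurable fun z => D.Holds i n z ∧ D.minAddr i z (D.b n (D.f z)) = n :=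
      .and (D.measurable_holds i n) (D.measurable_minAddr_eq i n)
    have hb : Measurable fun z => D.b n (D.f z) := (D.b_meas n).comp D.f_meas
    exact .or hE (.and hS (.and hX (.and (h1.comp measurable_fst) (.and (h1.comp measurable_snd)
      ((D.T_meas i).comp ((hb.comp measurable_fst).prodMk (hb.comp measurable_snd)))))))
  | some (.inr (t, l, k)) =>
    exact .or hE (.and hS (.and hX (.or (D.measurable_eRel t l k)
      ((D.measurable_eRel t l k).comp measurable_swap))))

end TreeAction

namespace TreeAction

variable {X Y ι : Type} [MeasurableSpace X] [MeasurableSpace Y] (D : TreeAction X Y ι)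

theorem rel_refl (x : X) : D.S.rel x x := D.S.refl x (by rw [D.dom_univ]; trivial)

theorem rel_a (n : ℕ) (x : X) : D.S.rel x (D.a n x) := (D.S_iff _ _).2 ⟨n, rfl⟩

variable {D} {x x' : X} {y y' : Y} {i : ι}

theorem step_T (k : ℕ) (y : Y) : D.T (D.code k).1 y (D.step k y) := by
  unfold step
  split_ifs with h
  · exact h
  · exact (D.T_equiv _).refl y

theorem exists_step (h : D.T i y y') : ∃ k, D.step k y = y' := by
  obtain ⟨n, hn⟩ := D.b_of_gen y y' (GenBy.of h)
  obtain ⟨k, hk⟩ := D.code_surj (i, n)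
  have h' : D.T (D.code k).1 y (D.b (D.code k).2 y) := by rwa [hk, hn]
  exact ⟨k, by rw [step, if_pos h', hk, hn]⟩

theorem near_zero : D.Near 0 x y ↔ ∃ z, D.S.rel x z ∧ D.f z = y := by
  constructor
  · rintro ⟨n, hn⟩
    exact ⟨_, D.rel_a n x, hn⟩
  · rintro ⟨z, hz, rfl⟩
    obtain ⟨n, rfl⟩ := (D.S_iff _ _).1 hz
    exact ⟨n, rfl⟩

theorem near_congr (h : D.S.rel x x') (n : ℕ) : D.Near n x = D.Near n x' := by
  induction n with
  | zero =>
    funext y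
    rw [eq_iff_iff, near_zero, near_zero]
    exact ⟨fun ⟨z, hz, e⟩ => ⟨z, D.S.trans (D.S.symm h) hz, e⟩,
      fun ⟨z, hz, e⟩ => ⟨z, D.S.trans h hz, e⟩⟩
  | succ n ih =>
    funext y
    simp only [Near, ih]

theorem dist_congr (h : D.S.rel x x') : D.dist x = D.dist x' := by
  funext y
  simp only [dist, near_congr h]

theorem move_congr (h : D.S.rel x x') : D.move x = D.move x' := by
  funext y
  simp only [move, near_congr h, dist_congr h]

theorem parent_congr (h : D.S.rel x x') : D.parent x = D.parent x' := by
  funext y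
  simp only [parent, move_congr h]

theorem label_congr (h : D.S.rel x x') : D.label x = D.label x' := by
  funext y
  simp only [label, move_congr h]

theorem stays_congr (h : D.S.rel x x') : D.Stays i x = D.Stays i x' := by
  funext y
  simp only [Stays, dist_congr h, label_congr h]

theorem lvl_congr (h : D.S.rel x x') : D.lvl x = D.lvl x' := by
  funext y
  unfold lvl
  congr 1
  ext n
  constructor
  · rintro ⟨l, e⟩
    obtain ⟨k, hk⟩ := (D.S_iff _ _).1 (D.S.trans (D.S.symm h) (D.rel_a l x))
    exact ⟨k, by rwa [hk]⟩
  · rintro ⟨l, e⟩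
    obtain ⟨k, hk⟩ := (D.S_iff _ _).1 (D.S.trans h (D.rel_a l x'))
    exact ⟨k, by rwa [hk]⟩

theorem exists_near (h : GenBy D.T (D.f x) y) : ∃ n, D.Near n x y := by
  have key : ∀ y y', GenBy D.T y y' → ((∃ n, D.Near n x y) ↔ ∃ n, D.Near n x y') := by
    intro y y' h
    induction h with
    | rel y y' h =>
      obtain ⟨i, h⟩ := h
      constructor
      · rintro ⟨n, hn⟩
        obtain ⟨k, hk⟩ := exists_step ((D.T_equiv i).symm h)
        exact ⟨n + 1, k, by rwa [hk]⟩
      · rintro ⟨n, hn⟩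
        obtain ⟨k, hk⟩ := exists_step h
        exact ⟨n + 1, k, by rwa [hk]⟩
    | refl y => exact Iff.rfl
    | symm _ _ _ ih => exact ih.symm
    | trans _ _ _ _ _ ih ih' => exact ih.trans ih'
  exact (key _ _ h).1 ⟨0, near_zero.2 ⟨x, D.rel_refl x, rfl⟩⟩

theorem near_dist (h : GenBy D.T (D.f x) y) : D.Near (D.dist x y) x y :=
  Nat.sInf_mem (s := {n | D.Near n x y}) (exists_near h)

theorem T_parent (x : X) (y : Y) : D.T (D.label x y) y (D.parent x y) := step_T _ _

theorem gen_parent (h : GenBy D.T (D.f x) y) : GenBy D.T (D.f x) (D.parent x y) :=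
  h.trans (.of (T_parent x y))

theorem dist_parent (h : GenBy D.T (D.f x) y) {n : ℕ} (hn : D.dist x y = n + 1) :
    D.dist x (D.parent x y) = n := by
  have h1 : D.Near n x (D.parent x y) := by
    have h0 := near_dist h
    rw [hn] at h0
    have := Nat.sInf_mem (s := {k | D.Near (D.dist x y - 1) x (D.step k y)})
      (by rw [hn]; exact h0)
    rw [hn] at this
    simpa [parent, move, hn] using this
  refine le_antisymm (Nat.sInf_le h1) ?_
  have h2 : D.Near (D.dist x (D.parent x y) + 1) x y := ⟨_, near_dist (gen_parent h)⟩
  have := Nat.sInf_le (s := {n | D.Near n x y}) (m := D.dist x (D.parent x y) + 1) h2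
  change D.dist x y ≤ _ at this
  omega

theorem dist_induction {P : Y → Prop}
    (zero : ∀ y, GenBy D.T (D.f x) y → D.dist x y = 0 → P y)
    (parent : ∀ y, GenBy D.T (D.f x) y → D.dist x y ≠ 0 → P (D.parent x y) → P y)
    (h : GenBy D.T (D.f x) y) : P y := by
  obtain ⟨n, hn⟩ : ∃ n, D.dist x y = n := ⟨_, rfl⟩
  induction n generalizing y with
  | zero => exact zero y h hn
  | succ n ih => exact parent y h (by omega) (ih (gen_parent h) (dist_parent h hn))

theorem lift_spec (h : ∃ z, D.S.rel x z ∧ D.f z = y) :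
    D.S.rel x (D.lift x y) ∧ D.f (D.lift x y) = y ∧ D.κ (D.lift x y) = D.lvl x y := by
  refine ⟨D.rel_a _ _, ?_⟩
  refine Nat.sInf_mem (s := {l | D.f (D.a l x) = y ∧ D.κ (D.a l x) = D.lvl x y}) ?_
  obtain ⟨l, h1, h2⟩ := Nat.sInf_mem (s := {n | ∃ l, D.f (D.a l x) = y ∧ D.κ (D.a l x) = n}) (by
    obtain ⟨z, hz, hy⟩ := h
    obtain ⟨l, rfl⟩ := (D.S_iff _ _).1 hz
    exact ⟨_, l, hy, rfl⟩)
  exact ⟨l, h1, h2⟩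

theorem exists_of_dist_eq_zero (h : GenBy D.T (D.f x) y) (h0 : D.dist x y = 0) :
    ∃ z, D.S.rel x z ∧ D.f z = y := near_zero.1 (h0 ▸ near_dist h)

theorem lift_congr (hx : x ∈ D.X₀) (h : D.S.rel x x') (hy : ∃ z, D.S.rel x z ∧ D.f z = y) :
    D.lift x y = D.lift x' y := by
  obtain ⟨a1, a2, a3⟩ := lift_spec hy
  obtain ⟨b1, b2, b3⟩ := lift_spec (x := x') (y := y)
    (hy.imp fun z hz => ⟨D.S.trans (D.S.symm h) hz.1, hz.2⟩)
  exact D.f_inj _ _ (D.X₀_inv _ _ a1 hx) (D.S.trans (D.S.symm a1) (D.S.trans h b1))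
    (a2.trans b2.symm) (by rw [a3, b3, lvl_congr h])

theorem root_of_dist_eq_zero (h0 : D.dist x y = 0) : D.root x y = D.lift x y := by
  simp only [root, h0, rootAux]

theorem root_parent (h : GenBy D.T (D.f x) y) (h0 : D.dist x y ≠ 0) :
    D.root x (D.parent x y) = D.root x y := by
  obtain ⟨n, hn⟩ := Nat.exists_eq_succ_of_ne_zero h0
  simp only [root, hn, rootAux, dist_parent h hn]

theorem root_spec (h : GenBy D.T (D.f x) y) :
    D.S.rel x (D.root x y) ∧ D.root x (D.f (D.root x y)) = D.root x y := by
  refine dist_induction (P := fun y => D.S.rel x (D.root x y) ∧ D.root x (D.f (D.root x y)) = D.root x y) (fun y h h0 => ?_) (fun y h h0 ih => ?_) h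
  · obtain ⟨h1, h2, -⟩ := lift_spec (exists_of_dist_eq_zero h h0)
    rw [root_of_dist_eq_zero h0, h2, root_of_dist_eq_zero h0]
    exact ⟨h1, rfl⟩
  · rwa [root_parent h h0] at ih

theorem f_root (h : GenBy D.T (D.f x) y) (h0 : D.dist x y = 0) : D.f (D.root x y) = y := by
  rw [root_of_dist_eq_zero h0]
  exact (lift_spec (exists_of_dist_eq_zero h h0)).2.1

theorem gen_congr (hx : x ∈ D.X₀) (h : D.S.rel x x') :
    GenBy D.T (D.f x) y ↔ GenBy D.T (D.f x') y :=
  ⟨fun h' => (D.conn _ _ hx h).symm.trans h', fun h' => (D.conn _ _ hx h).trans h'⟩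

theorem root_congr (hx : x ∈ D.X₀) (h : D.S.rel x x') (hy : GenBy D.T (D.f x) y) :
    D.root x y = D.root x' y := by
  refine dist_induction (P := fun y => D.root x y = D.root x' y) (fun y hy h0 => ?_)
    (fun y hy h0 ih => ?_) hy
  · rw [root_of_dist_eq_zero h0, root_of_dist_eq_zero (by rwa [← dist_congr h])]
    exact lift_congr hx h (exists_of_dist_eq_zero hy h0)
  · rw [root_parent hy h0, parent_congr h, root_parent ((gen_congr hx h).1 hy)
      (by rwa [← dist_congr h])] at ih
    exact ih

theorem addr_spec (hx : x ∈ D.X₀) (h : GenBy D.T (D.f x) y) :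
    D.b (D.addr x y) (D.f (D.root x y)) = y :=
  Nat.sInf_mem (s := {n | D.b n (D.f (D.root x y)) = y})
    (D.b_of_gen _ _ ((gen_congr hx (root_spec h).1).1 h))

theorem addr_congr (hx : x ∈ D.X₀) (h : D.S.rel x x') (hy : GenBy D.T (D.f x) y) :
    D.addr x y = D.addr x' y := by
  simp only [addr, root_congr hx h hy]

variable (D) in
open Classical in
/-- Move at most `n` times inside the `T i`-class. -/
noncomputable def topAux (i : ι) (x : X) : ℕ → Y → Y
  | 0, y => y
  | n + 1, y => if D.Stays i x y then y else topAux i x n (D.parent x y)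

variable (D) in
/-- The staying point reached from `y` by moving inside its `T i`-class. -/
noncomputable def top (i : ι) (x : X) (y : Y) : Y := D.topAux i x (D.dist x y) y

theorem top_of_stays (h : D.Stays i x y) : D.top i x y = y := by
  unfold top
  cases D.dist x y with
  | zero => rfl
  | succ n => simp only [topAux, if_pos h]

theorem top_parent (h : GenBy D.T (D.f x) y) (hs : ¬ D.Stays i x y) :
    D.top i x (D.parent x y) = D.top i x y := by
  obtain ⟨n, hn⟩ := Nat.exists_eq_succ_of_ne_zero fun h0 => hs (Or.inl h0)
  simp only [top, hn, topAux, if_neg hs, dist_parent h hn]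

theorem label_eq (hs : ¬ D.Stays i x y) : D.label x y = i :=
  not_not.1 fun h => hs (Or.inr h)

theorem top_spec (h : GenBy D.T (D.f x) y) :
    D.T i y (D.top i x y) ∧ D.Stays i x (D.top i x y) ∧
      D.root x (D.top i x y) = D.root x y := by
  refine dist_induction (P := fun y => D.T i y (D.top i x y) ∧ D.Stays i x (D.top i x y) ∧
      D.root x (D.top i x y) = D.root x y) (fun y h h0 => ?_) (fun y h h0 ih => ?_) h
  · rw [top_of_stays (Or.inl h0)]
    exact ⟨(D.T_equiv i).refl y, Or.inl h0, rfl⟩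
  · by_cases hs : D.Stays i x y
    · rw [top_of_stays hs]
      exact ⟨(D.T_equiv i).refl y, hs, rfl⟩
    · rw [top_parent h hs, root_parent h h0] at ih
      refine ⟨(D.T_equiv i).trans ?_ ih.1, ih.2⟩
      have := T_parent (D := D) x y
      rwa [label_eq hs] at this

theorem anchor_spec (h : GenBy D.T (D.f x) y) :
    D.T i y (D.anchor i x y) ∧ D.Stays i x (D.anchor i x y) ∧
      D.addr x (D.anchor i x y) = D.minAddr i x y := by
  refine Nat.sInf_mem (s := {l | D.T i y (D.b l y) ∧ D.Stays i x (D.b l y) ∧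
    D.addr x (D.b l y) = D.minAddr i x y}) ?_
  obtain ⟨l, hl⟩ := Nat.sInf_mem (s := {n | ∃ l, D.T i y (D.b l y) ∧ D.Stays i x (D.b l y) ∧
    D.addr x (D.b l y) = n}) (by
      obtain ⟨h1, h2, -⟩ := top_spec (i := i) h
      obtain ⟨l, hl⟩ := D.b_of_gen _ _ (GenBy.of h1)
      exact ⟨_, l, by rwa [hl], by rwa [hl], rfl⟩)
  exact ⟨l, hl⟩

theorem minAddr_eq_of_T (h : D.T i y y') : D.minAddr i x y = D.minAddr i x y' := by
  unfold minAddr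
  congr 1
  ext n
  constructor
  · rintro ⟨l, h1, h2⟩
    have h3 := (D.T_equiv i).trans ((D.T_equiv i).symm h) h1
    obtain ⟨k, hk⟩ := D.b_of_gen _ _ (GenBy.of h3)
    exact ⟨k, by rwa [hk], by rwa [hk]⟩
  · rintro ⟨l, h1, h2⟩
    have h3 := (D.T_equiv i).trans h h1
    obtain ⟨k, hk⟩ := D.b_of_gen _ _ (GenBy.of h3)
    exact ⟨k, by rwa [hk], by rwa [hk]⟩

theorem minAddr_congr (hx : x ∈ D.X₀) (h : D.S.rel x x') (hy : GenBy D.T (D.f x) y) :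
    D.minAddr i x y = D.minAddr i x' y := by
  unfold minAddr
  congr 1
  ext n
  refine exists_congr fun l => and_congr_right fun hT => ?_
  rw [stays_congr h, addr_congr hx h (hy.trans (.of hT))]

theorem anchor_congr (hx : x ∈ D.X₀) (h : D.S.rel x x') (hy : GenBy D.T (D.f x) y) :
    D.anchor i x y = D.anchor i x' y := by
  unfold anchor
  congr 2
  ext l
  refine and_congr_right fun hT => ?_
  rw [stays_congr h, addr_congr hx h (hy.trans (.of hT)), minAddr_congr hx h hy]

theorem rel_edge {z : X} (hz : z ∈ D.X₀) (t : Option (ι × ℕ)) : D.S.rel z (D.edge t z) := by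
  match t with
  | none => exact (root_spec .rfl).1
  | some (i, n) =>
    simp only [edge]
    split_ifs
    · have h1 : GenBy D.T (D.f z) (D.b n (D.f z)) := D.gen_b z hz _ .rfl n
      exact (root_spec (h1.trans (.of (anchor_spec h1).1))).1
    · exact D.rel_refl z

theorem a_mapIdx {z z' : X} (h : D.S.rel z z') : D.a (D.mapIdx z z') z = z' :=
  Nat.sInf_mem (s := {l | D.a l z = z'}) ((D.S_iff _ _).1 h)

theorem sep_sepIdx {z z' : X} (h : z ≠ z') :
    z ∈ D.sep (D.sepIdx z z') ∧ z' ∉ D.sep (D.sepIdx z z') :=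
  Nat.sInf_mem (s := {k | z ∈ D.sep k ∧ z' ∉ D.sep k}) (D.sep_spec _ _ h)

variable (D) in
theorem newRel_refl (j) (z : X) : D.newRel j z z := by
  match j with
  | none => exact Or.inl rfl
  | some (.inl (i, n)) => exact Or.inl rfl
  | some (.inr (t, l, k)) => exact Or.inl rfl

theorem newRel_rel {j} {z z' : X} (h : D.newRel j z z') : D.S.rel z z' := by
  match j, h with
  | none, h => exact h.elim (fun h => h ▸ D.rel_refl z) fun h => h.1
  | some (.inl (i, n)), h => exact h.elim (fun h => h ▸ D.rel_refl z) fun h => h.1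
  | some (.inr (t, l, k)), h => exact h.elim (fun h => h ▸ D.rel_refl z) fun h => h.1

theorem newRel_edge {z : X} (hz : z ∈ D.X₀) (t : Option (ι × ℕ)) :
    ∃ j, D.newRel j z (D.edge t z) := by
  by_cases h : z = D.edge t z
  · exact ⟨none, Or.inl h⟩
  · exact ⟨some (.inr (t, D.mapIdx z (D.edge t z), D.sepIdx z (D.edge t z))), Or.inr
      ⟨rel_edge hz t, hz, Or.inl ⟨rfl, ⟨rfl, rfl⟩, a_mapIdx (rel_edge hz t), sep_sepIdx h⟩⟩⟩

theorem newRel_symm {j} {z z' : X} (h : D.newRel j z z') : D.newRel j z' z := by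
  match j, h with
  | none, h =>
    exact h.imp Eq.symm fun h => ⟨D.S.symm h.1, fun h' => h.2 (D.X₀_inv _ _ (D.S.symm h.1) h')⟩
  | some (.inl (i, n)), h =>
    exact h.imp Eq.symm fun h => ⟨D.S.symm h.1, D.X₀_inv _ _ h.1 h.2.1, h.2.2.2.1, h.2.2.1,
      (D.T_equiv i).symm h.2.2.2.2⟩
  | some (.inr (t, l, k)), h =>
    exact h.imp Eq.symm fun h => ⟨D.S.symm h.1, D.X₀_inv _ _ h.1 h.2.1, h.2.2.symm⟩

theorem newRel_trans {j} {z z' z'' : X} (h : D.newRel j z z') (h' : D.newRel j z' z'') :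
    D.newRel j z z'' := by
  match j, h, h' with
  | none, h, h' =>
    rcases h with rfl | h
    · exact h'
    rcases h' with rfl | h'
    · exact Or.inr h
    exact Or.inr ⟨D.S.trans h.1 h'.1, h.2⟩
  | some (.inl (i, n)), h, h' =>
    rcases h with rfl | h
    · exact h'
    rcases h' with rfl | h'
    · exact Or.inr h
    exact Or.inr ⟨D.S.trans h.1 h'.1, h.2.1, h.2.2.1, h'.2.2.2.1,
      (D.T_equiv i).trans h.2.2.2.2 h'.2.2.2.2⟩
  | some (.inr (t, l, k)), h, h' =>
    rcases h with rfl | h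
    · exact h'
    rcases h' with rfl | h'
    · exact Or.inr h
    obtain ⟨-, -, h⟩ := h
    obtain ⟨-, -, h'⟩ := h'
    left
    rcases h with ⟨-, -, e, s1, s2⟩ | ⟨-, -, e, s1, s2⟩ <;>
      rcases h' with ⟨-, -, e', s1', s2'⟩ | ⟨-, -, e', s1', s2'⟩
    · exact absurd s1' s2
    · exact D.a_inj l (e.trans e'.symm)
    · exact e.symm.trans e'
    · exact absurd s1 s2'

variable [StandardBorelSpace X] [StandardBorelSpace Y]

variable (D) in
/-- The members of the new decomposition. -/
def fam (j : Option ((ι × ℕ) ⊕ (Option (ι × ℕ) × ℕ × ℕ))) : CBER X where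
  dom := Set.univ
  dom_meas := .univ
  rel := D.newRel j
  rel_meas := measurableSet_setOfPred.2 (D.measurable_newRel j)
  rel_dom := fun _ => ⟨trivial, trivial⟩
  refl := fun x _ => D.newRel_refl j x
  symm := newRel_symm
  trans := newRel_trans
  countable_classes := fun x => (D.S.countable_classes x).mono fun _ h => newRel_rel h

end TreeAction

namespace TreeAction

variable {X Y ι : Type} [MeasurableSpace X] [MeasurableSpace Y] {D : TreeAction X Y ι}
  {x x' : X} {y y' : Y} {i : ι}

theorem holds_root (hx : x ∈ D.X₀) (h : GenBy D.T (D.f x) y) (hs : D.Stays i x y) :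
    D.Holds i (D.addr x y) (D.root x y) := by
  have h1 := (root_spec h).1
  unfold Holds
  rw [addr_spec hx h, ← root_congr hx h1 h, ← addr_congr hx h1 h, ← stays_congr h1]
  exact ⟨rfl, rfl, hs⟩

theorem minAddr_root (hx : x ∈ D.X₀) (h : GenBy D.T (D.f x) y) :
    D.minAddr i (D.root x y) (D.b (D.addr x y) (D.f (D.root x y))) = D.minAddr i x y := by
  rw [addr_spec hx h, ← minAddr_congr hx (root_spec h).1 h]

theorem edge_root (hx : x ∈ D.X₀) (h : GenBy D.T (D.f x) y) (hs : D.Stays i x y)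
    (hm : D.addr x y ≠ D.minAddr i x y) :
    D.edge (some (i, D.addr x y)) (D.root x y) = D.root x (D.anchor i x y) := by
  have h1 := (root_spec h).1
  simp only [edge]
  rw [if_pos ⟨holds_root hx h hs, by rw [minAddr_root hx h]; exact hm.symm⟩, addr_spec hx h,
    ← anchor_congr hx h1 h, ← root_congr hx h1 (h.trans (.of (anchor_spec h).1))]

theorem newRel_root (hx : x ∈ D.X₀) (h : GenBy D.T (D.f x) y) (hs : D.Stays i x y)
    (hs' : D.Stays i x y') (hT : D.T i y y') (hm : D.addr x y = D.minAddr i x y)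
    (hm' : D.addr x y' = D.minAddr i x y') :
    ∃ j, D.newRel j (D.root x y) (D.root x y') := by
  have h' := h.trans (.of hT)
  have e := hm.trans ((minAddr_eq_of_T hT).trans hm'.symm)
  refine ⟨some (.inl (i, D.addr x y)), Or.inr ⟨D.S.trans (D.S.symm (root_spec h).1)
    (root_spec h').1, D.X₀_inv _ _ (root_spec h).1 hx, ⟨holds_root hx h hs, ?_⟩, ?_, ?_⟩⟩
  · rw [minAddr_root hx h, hm]
  · rw [e]
    exact ⟨holds_root hx h' hs', by rw [minAddr_root hx h', hm']⟩
  · rw [addr_spec hx h, e, addr_spec hx h']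
    exact hT

theorem genBy_root_anchor (hx : x ∈ D.X₀) (h : GenBy D.T (D.f x) y) (hs : D.Stays i x y) :
    GenBy D.newRel (D.root x y) (D.root x (D.anchor i x y)) := by
  obtain ⟨a1, a2, a3⟩ := anchor_spec (i := i) h
  by_cases hm : D.addr x y = D.minAddr i x y
  · obtain ⟨j, hj⟩ := newRel_root hx h hs a2 a1 hm (by rw [a3, minAddr_eq_of_T a1])
    exact .of hj
  · rw [← edge_root hx h hs hm]
    obtain ⟨j, hj⟩ := newRel_edge (D.X₀_inv _ _ (root_spec h).1 hx) (some (i, D.addr x y))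
    exact .of hj

theorem genBy_root_of_T (hx : x ∈ D.X₀) (h : GenBy D.T (D.f x) y) (hT : D.T i y y') :
    GenBy D.newRel (D.root x y) (D.root x y') := by
  have key : ∀ y, GenBy D.T (D.f x) y → ∃ w, D.T i y w ∧ D.Stays i x w ∧
      D.addr x w = D.minAddr i x w ∧ GenBy D.newRel (D.root x y) (D.root x w) := by
    intro y h
    obtain ⟨t1, t2, t3⟩ := top_spec (i := i) h
    have ht := h.trans (.of t1)
    obtain ⟨a1, a2, a3⟩ := anchor_spec (i := i) ht
    refine ⟨_, (D.T_equiv i).trans t1 a1, a2, by rw [a3, minAddr_eq_of_T a1], ?_⟩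
    rw [← t3]
    exact genBy_root_anchor hx ht t2
  obtain ⟨w, w1, w2, w3, w4⟩ := key y h
  obtain ⟨w', w1', w2', w3', w4'⟩ := key y' (h.trans (.of hT))
  obtain ⟨j, hj⟩ := newRel_root hx (h.trans (.of w1)) w2 w2'
    ((D.T_equiv i).trans ((D.T_equiv i).symm w1) ((D.T_equiv i).trans hT w1')) w3 w3'
  exact w4.trans ((GenBy.of hj).trans w4'.symm)

theorem genBy_root (hx : x ∈ D.X₀) (h : GenBy D.T (D.f x) y) (h' : GenBy D.T y y') :
    GenBy D.newRel (D.root x y) (D.root x y') := by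
  induction h' with
  | rel y y' hT =>
    obtain ⟨i, hT⟩ := hT
    exact genBy_root_of_T hx h hT
  | refl y => exact .rfl
  | symm y y' h1 ih => exact (ih (h.trans (.symm h1))).symm
  | trans y y' y'' h1 h2 ih ih' => exact (ih h).trans (ih' (h.trans h1))

theorem genBy_newRel (h : D.S.rel x x') : GenBy D.newRel x x' := by
  by_cases hx : x ∈ D.X₀
  · have key : ∀ z, D.S.rel x z → GenBy D.newRel z (D.root x (D.f z)) := fun z hz => by
      obtain ⟨j, hj⟩ := newRel_edge (D.X₀_inv _ _ hz hx) none
      have := root_congr hx hz (D.conn _ _ hx hz)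
      rw [this]
      exact .of hj
    exact (key x (D.rel_refl x)).trans ((genBy_root hx .rfl (D.conn _ _ hx h)).trans
      (key x' h).symm)
  · exact .of (i := none) (Or.inr ⟨h, hx⟩)

theorem rel_of_genBy (h : GenBy D.newRel x x') : D.S.rel x x' := by
  induction h with
  | rel _ _ h => exact h.elim fun _ => newRel_rel
  | refl x => exact D.rel_refl x
  | symm _ _ _ ih => exact D.S.symm ih
  | trans _ _ _ _ _ ih ih' => exact D.S.trans ih ih'

/-! ### Free independence -/

/-- The index set of the new decomposition. -/
abbrev Idx (ι : Type) : Type := Option ((ι × ℕ) ⊕ (Option (ι × ℕ) × ℕ × ℕ))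

/-- The group of values of the universal cocycle. -/
abbrev Univ (X ι : Type) : Type := Monoid.CoprodI fun _ : Idx ι => FreeGroup X

/-- The generator of the universal group attached to an index and a point. -/
def gen (j : Idx ι) (z : X) : Univ X ι :=
  Monoid.CoprodI.of (M := fun _ : Idx ι => FreeGroup X) (i := j) (FreeGroup.of z)

variable (D) in
/-- The value of the universal cocycle along an edge of a given type. -/
noncomputable def edgeVal (t : Option (ι × ℕ)) (z z' : X) : Univ X ι :=
  (gen (some (.inr (t, D.mapIdx z z', D.sepIdx z z'))) z)⁻¹ *
    gen (some (.inr (t, D.mapIdx z z', D.sepIdx z z'))) z'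

theorem edgeVal_self (t : Option (ι × ℕ)) (z : X) : D.edgeVal t z z = 1 := inv_mul_cancel _

variable (D) in
open Classical in
/-- The potential of a staying point. -/
noncomputable def stayPot (i : ι) (x : X) (y : Y) : Univ X ι :=
  if D.addr x y = D.minAddr i x y then (gen (some (.inl (i, D.minAddr i x y))) (D.root x y))⁻¹
  else D.edgeVal (some (i, D.addr x y)) (D.root x y) (D.root x (D.anchor i x y)) *
    (gen (some (.inl (i, D.minAddr i x y))) (D.root x (D.anchor i x y)))⁻¹

variable (D) in
/-- The potential of a point. -/
noncomputable def pot (i : ι) (x : X) (y : Y) : Univ X ι := D.stayPot i x (D.top i x y)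

theorem pot_parent (h : GenBy D.T (D.f x) y) (h0 : D.dist x y ≠ 0) :
    D.pot (D.label x y) x (D.parent x y) = D.pot (D.label x y) x y := by
  rw [pot, pot, top_parent h]
  rintro (h | h)
  · exact h0 h
  · exact h rfl

theorem exists_cocycle (hx : x ∈ D.X₀) : ∃ c : X → X → Univ X ι,
    (∀ z z' z'', D.S.rel x z → D.S.rel x z' → D.S.rel x z'' → c z z'' = c z z' * c z' z'') ∧
    ∀ j z z', D.S.rel x z → D.newRel j z z' → c z z' = (gen j z)⁻¹ * gen j z' := by
  obtain ⟨c, hc, hcT⟩ := D.ext (Univ X ι) (fun i y y' => D.pot i x y * (D.pot i x y')⁻¹)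
    (fun i y y' y'' _ _ => by group) x hx
  have hself : ∀ y, GenBy D.T (D.f x) y → c y y = 1 := fun y hy => by
    simpa using hc y y y hy hy hy
  have hroot : ∀ y, GenBy D.T (D.f x) y → c y (D.f (D.root x y)) = 1 := by
    refine fun y hy => dist_induction (P := fun y => c y (D.f (D.root x y)) = 1)
      (fun y h h0 => ?_) (fun y h h0 ih => ?_) hy
    · rw [f_root h h0, hself y h]
    · have hr := root_spec h
      rw [hc y (D.parent x y) _ h (gen_parent h) (D.conn _ _ hx hr.1), hcT _ y _ h (T_parent x y),
        pot_parent h h0, mul_inv_cancel, one_mul, ← root_parent h h0, ih]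
  let lam : X → Univ X ι := fun z => D.edgeVal none z (D.root x (D.f z))
  have hlam : ∀ y, GenBy D.T (D.f x) y → lam (D.root x y) = 1 := fun y hy => by
    simp only [lam]
    rw [(root_spec hy).2, edgeVal_self]
  have hcS : ∀ z z' z'', D.S.rel x z → D.S.rel x z' → D.S.rel x z'' →
      lam z * c (D.f z) (D.f z'') * (lam z'')⁻¹ = lam z * c (D.f z) (D.f z') * (lam z')⁻¹ *
        (lam z' * c (D.f z') (D.f z'') * (lam z'')⁻¹) := by
    intro z z' z'' h h' h''
    rw [hc _ (D.f z') _ (D.conn _ _ hx h) (D.conn _ _ hx h') (D.conn _ _ hx h'')]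
    group
  have hcr : ∀ i y y', GenBy D.T (D.f x) y → D.T i y y' →
      c (D.f (D.root x y)) (D.f (D.root x y')) = D.pot i x y * (D.pot i x y')⁻¹ := by
    intro i y y' hy hT
    have hy' := hy.trans (.of hT)
    have r := D.conn _ _ hx (root_spec hy).1
    have r' := D.conn _ _ hx (root_spec hy').1
    have h1 := hc (D.f (D.root x y)) y (D.f (D.root x y)) r hy r
    rw [hself _ r, hroot y hy, mul_one] at h1
    rw [hc _ y _ r hy r', hc y y' _ hy hy' r', ← h1, hroot y' hy', hcT i y y' hy hT]
    group
  have hE : ∀ t z, D.S.rel x z → lam z * c (D.f z) (D.f (D.edge t z)) * (lam (D.edge t z))⁻¹ =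
      D.edgeVal t z (D.edge t z) := by
    intro t z hz
    have hfz := D.conn _ _ hx hz
    match t with
    | none =>
      have e : D.edge none z = D.root x (D.f z) := (root_congr hx hz hfz).symm
      rw [e, hroot _ hfz, hlam _ hfz]
      simp [lam]
    | some (i, n) =>
      by_cases hcond : D.Holds i n z ∧ D.minAddr i z (D.b n (D.f z)) ≠ n
      · obtain ⟨⟨h1, h2, h3⟩, h4⟩ := hcond
        have hy : GenBy D.T (D.f x) (D.b n (D.f z)) := hfz.trans (D.gen_b x hx _ hfz n)
        rw [← root_congr hx hz hy] at h1
        rw [← addr_congr hx hz hy] at h2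
        rw [← stays_congr hz] at h3
        rw [← minAddr_congr hx hz hy] at h4
        generalize D.b n (D.f z) = y at *
        subst h1 h2
        obtain ⟨a1, a2, a3⟩ := anchor_spec (i := i) hy
        have ha := hy.trans (.of a1)
        have ea := minAddr_eq_of_T (x := x) a1
        rw [edge_root hx hy h3 (Ne.symm h4), hlam _ hy, hlam _ ha, hcr i _ _ hy a1, pot, pot,
          top_of_stays h3, top_of_stays a2, stayPot, stayPot, if_neg (Ne.symm h4),
          if_pos (by rw [a3, ea]), ea]
        group
      · have e : D.edge (some (i, n)) z = z := by
          simp only [edge]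
          rw [if_neg hcond]
        rw [e, hself _ hfz, edgeVal_self]
        group
  have hER : ∀ t l k z z', D.S.rel x z → D.ERel t l k z z' →
      lam z * c (D.f z) (D.f z') * (lam z')⁻¹ =
        (gen (some (.inr (t, l, k))) z)⁻¹ * gen (some (.inr (t, l, k))) z' := by
    rintro t l k z z' hz ⟨rfl, ⟨rfl, rfl⟩, -⟩
    exact hE t z hz
  have hone : ∀ z, D.S.rel x z → lam z * c (D.f z) (D.f z) * (lam z)⁻¹ = 1 := fun z hz => by
    rw [hself _ (D.conn _ _ hx hz)]
    group
  refine ⟨fun z z' => lam z * c (D.f z) (D.f z') * (lam z')⁻¹, hcS, fun j z z' hz hj => ?_⟩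
  have hz' := D.S.trans hz (newRel_rel hj)
  beta_reduce
  match j, hj with
  | none, Or.inl e => subst e; rw [hone z hz, inv_mul_cancel]
  | none, Or.inr ⟨_, h⟩ => exact absurd (D.X₀_inv _ _ hz hx) h
  | some (.inl (i, n)), Or.inl e => subst e; rw [hone z hz, inv_mul_cancel]
  | some (.inl (i, n)), Or.inr ⟨_, _, ⟨⟨h1, h2, h3⟩, h4⟩, ⟨⟨h1', h2', h3'⟩, h4'⟩, hT⟩ =>
    have hfz := D.conn _ _ hx hz
    have hfz' := D.conn _ _ hx hz'
    have hy : GenBy D.T (D.f x) (D.b n (D.f z)) := hfz.trans (D.gen_b x hx _ hfz n)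
    have hy' : GenBy D.T (D.f x) (D.b n (D.f z')) := hfz'.trans (D.gen_b x hx _ hfz' n)
    rw [← root_congr hx hz hy] at h1
    rw [← addr_congr hx hz hy] at h2
    rw [← stays_congr hz] at h3
    rw [← minAddr_congr hx hz hy] at h4
    rw [← root_congr hx hz' hy'] at h1'
    rw [← addr_congr hx hz' hy'] at h2'
    rw [← stays_congr hz'] at h3'
    rw [← minAddr_congr hx hz' hy'] at h4'
    generalize D.b n (D.f z) = y at *
    generalize D.b n (D.f z') = y' at *
    subst h1 h1'
    rw [hlam _ hy, hlam _ hy', hcr i _ _ hy hT, pot, pot, top_of_stays h3, top_of_stays h3',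
      stayPot, stayPot, if_pos (h2.trans h4.symm), if_pos (h2'.trans h4'.symm), h4, h4']
    group
  | some (.inr (t, l, k)), Or.inl e => subst e; rw [hone z hz, inv_mul_cancel]
  | some (.inr (t, l, k)), Or.inr ⟨_, _, Or.inl h⟩ => exact hER t l k z z' hz h
  | some (.inr (t, l, k)), Or.inr ⟨_, _, Or.inr h⟩ =>
    have h1 := hER t l k z' z hz' h
    have h2 := hcS z z' z hz hz' hz
    rw [hone z hz, h1] at h2
    rw [eq_inv_of_mul_eq_one_left h2.symm, mul_inv_rev, inv_inv]

variable [StandardBorelSpace X] [StandardBorelSpace Y]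

variable (D) in
theorem isFreeProduct_fam : IsFreeProduct D.S D.fam := by
  refine ⟨freelyIndep_of_cocycle D.fam D.S.rel D.rel_refl (fun _ _ _ => D.S.trans)
    (fun j z z' h => newRel_rel (j := j) h) fun x => ?_, ?_, fun z z' => ?_⟩
  · by_cases hx : x ∈ D.X₀
    · obtain ⟨c, hc, hj⟩ := exists_cocycle hx
      refine ⟨c, hc, fun j z z' hz h => ?_⟩
      rw [hj j z z' hz h, map_mul, map_inv]
      rfl
    · refine ⟨fun z z' => (gen none z)⁻¹ * gen none z', fun _ _ _ _ _ _ => by group,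
        fun j z z' hz h => ?_⟩
      have hnot : z ∉ D.X₀ := fun h' => hx (D.X₀_inv _ _ (D.S.symm hz) h')
      have key : ∀ j, D.newRel j z z' → z = z' ∨ j = none := fun j h => by
        match j, h with
        | none, _ => exact Or.inr rfl
        | some (.inl (i, n)), h => exact Or.inl (h.resolve_right fun h => hnot h.2.1)
        | some (.inr (t, l, k)), h => exact Or.inl (h.resolve_right fun h => hnot h.2.1)
      rw [map_mul, map_inv]
      rcases key j h with rfl | rfl
      · rw [inv_mul_cancel]
        exact inv_mul_cancel _
      · rfl
  · rw [D.dom_univ]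
    exact (Set.iUnion_eq_univ_iff.2 fun x => ⟨none, Set.mem_univ x⟩).symm
  · refine ⟨fun h => ⟨by rw [D.dom_univ]; trivial, genBy_newRel h⟩, fun h => rel_of_genBy h.2⟩

end TreeAction

namespace TreeAction

variable {X Y ι : Type} [MeasurableSpace X] [MeasurableSpace Y]
  [StandardBorelSpace X] [StandardBorelSpace Y]

/-- A freely indecomposable relation acting on the tree of a freely independent family is, up to
null sets, contained in the vertex relations: there is an invariant choice of a member of the
family and an equivariant choice of a class of this member. -/
theorem exists_vertex [Countable ι] (D : TreeAction X Y ι) (μ : Measure X)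
    (hFI : FreelyIndecomposableMod μ D.S) (hX₀ : μ D.X₀ᶜ = 0)
    (ha : ∀ n, Measure.QuasiMeasurePreserving (D.a n) μ μ)
    (hN : ∀ P, MeasurableSet P → (∀ x ∈ P, ∀ x' ∈ P, D.S.rel x x' → x = x') → μ P = 0) :
    ∃ X₁ : Set X, MeasurableSet X₁ ∧ μ X₁ᶜ = 0 ∧ X₁ ⊆ D.X₀ ∧
      (∀ x x', D.S.rel x x' → x ∈ X₁ → x' ∈ X₁) ∧
      ∃ (i : X → ι) (s : X → Y), (∀ j, MeasurableSet {x | i x = j}) ∧ Measurable s ∧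
        ∀ x ∈ X₁, GenBy D.T (D.f x) (s x) ∧
          ∀ x', D.S.rel x x' → i x = i x' ∧ D.T (i x) (s x) (s x') := by
  obtain ⟨U, C, hU, -, -, hC, hC0, hsec, hinv, hiff⟩ := hFI _ inferInstance D.fam
    D.isFreeProduct_fam
  have hUnone : μ (U none ∩ C ∩ D.X₀) = 0 := by
    refine hN _ (((hU _).inter hC).inter D.X₀_meas) fun x hx x' hx' h => ?_
    exact (((hiff none x hx.1 x' hx'.1).1 h).resolve_right fun h => h.2 hx.2)
  have hUinr : ∀ t, μ (U (some (.inr t)) ∩ C) = 0 := by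
    rintro ⟨t, l, k⟩
    rw [← Set.inter_union_sdiff (U (some (.inr (t, l, k))) ∩ C) (D.sep k)]
    refine measure_union_null ?_ ?_
    · refine hN _ (((hU _).inter hC).inter (D.sep_meas k)) fun x hx x' hx' h => ?_
      refine (((hiff _ x hx.1 x' hx'.1).1 h).resolve_right ?_)
      rintro ⟨-, -, h | h⟩
      · exact h.2.2.2.2 hx'.2
      · exact h.2.2.2.2 hx.2
    · refine hN _ (((hU _).inter hC).diff (D.sep_meas k)) fun x hx x' hx' h => ?_
      refine (((hiff _ x hx.1 x' hx'.1).1 h).resolve_right ?_)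
      rintro ⟨-, -, h | h⟩
      · exact hx.2 h.2.2.2.1
      · exact hx'.2 h.2.2.2.1
  let B : Set X := (Cᶜ ∪ D.X₀ᶜ) ∪ (U none ∩ C ∩ D.X₀ ∪ ⋃ t, U (some (.inr t)) ∩ C)
  have hB : MeasurableSet B := (hC.compl.union D.X₀_meas.compl).union
    ((((hU _).inter hC).inter D.X₀_meas).union (.iUnion fun t => (hU _).inter hC))
  have hB0 : μ B = 0 := measure_union_null (measure_union_null hC0 hX₀)
    (measure_union_null hUnone (measure_iUnion_null hUinr))
  let X₁ : Set X := (⋃ n, D.a n ⁻¹' B)ᶜ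
  have hX₁ : MeasurableSet X₁ := (MeasurableSet.iUnion fun n => D.a_meas n hB).compl
  have hmem : ∀ x ∈ X₁, ∀ x', D.S.rel x x' → x' ∉ B := by
    intro x hx x' h h'
    obtain ⟨n, rfl⟩ := (D.S_iff _ _).1 h
    exact hx (Set.mem_iUnion.2 ⟨n, h'⟩)
  have hX₁inv : ∀ x x', D.S.rel x x' → x ∈ X₁ → x' ∈ X₁ := by
    intro x x' h hx hx'
    obtain ⟨n, hn⟩ := Set.mem_iUnion.1 hx'
    exact hmem x hx _ (D.S.trans h (D.rel_a n x')) hn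
  have hX₁C : ∀ x ∈ X₁, x ∈ C ∧ x ∈ D.X₀ := by
    intro x hx
    have := hmem x hx x (D.rel_refl x)
    constructor
    · by_contra h
      exact this (Or.inl (Or.inl h))
    · by_contra h
      exact this (Or.inl (Or.inr h))
  let V : ℕ → Set X := fun k => U (some (.inl (D.code k)))
  let kk : X → ℕ := fun x => sInf {k | ∃ l, D.a l x ∈ V k}
  let ll : X → ℕ := fun x => sInf {l | D.a l x ∈ V (kk x)}
  have hV : ∀ k l, Measurable fun x => D.a l x ∈ V k := fun k l => (hU _).mem.comp (D.a_meas l)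
  have hkk : Measurable kk := measurable_sInf_nat fun k => .exists fun l => hV k l
  have hll : Measurable ll := measurable_sInf_nat fun l =>
    Measurable.select_nat (F := fun k x => D.a l x ∈ V k) (fun k => hV k l) hkk
  have hspec : ∀ x ∈ X₁, D.a (ll x) x ∈ V (kk x) := by
    intro x hx
    obtain ⟨y, hy, hxy⟩ := hsec x ⟨by rw [D.dom_univ]; trivial, (hX₁C x hx).1⟩
    obtain ⟨j, hj⟩ := Set.mem_iUnion.1 hy
    have hy1 := hX₁C y (hX₁inv x y hxy hx)
    have hyB := hmem x hx y hxy
    refine Nat.sInf_mem (s := {l | D.a l x ∈ V (kk x)}) ?_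
    refine Nat.sInf_mem (s := {k | ∃ l, D.a l x ∈ V k}) ?_
    match j, hj with
    | none, hj => exact (hyB (Or.inr (Or.inl ⟨⟨hj, hy1.1⟩, hy1.2⟩))).elim
    | some (.inr t), hj => exact (hyB (Or.inr (Or.inr (Set.mem_iUnion.2 ⟨t, hj, hy1.1⟩)))).elim
    | some (.inl p), hj =>
      obtain ⟨k, rfl⟩ := D.code_surj p
      obtain ⟨l, rfl⟩ := (D.S_iff _ _).1 hxy
      exact ⟨k, l, hj⟩
  refine ⟨X₁, hX₁, ?_, fun x hx => (hX₁C x hx).2, hX₁inv, fun x => (D.code (kk x)).1,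
    fun x => D.b (D.code (kk x)).2 (D.f (D.a (ll x) x)), ?_, ?_, ?_⟩
  · rw [compl_compl]
    exact measure_iUnion_null fun n => (ha n).preimage_null hB0
  · exact fun j => measurableSet_setOfPred.2
      ((measurable_of_countable fun k => (D.code k).1 = j).comp hkk)
  · refine Measurable.select_nat (F := fun k x => D.b (D.code k).2 (D.f (D.a (ll x) x)))
      (fun k => (D.b_meas _).comp (D.f_meas.comp ?_)) hkk
    exact Measurable.select_nat D.a_meas hll
  · intro x hx
    have hx0 := (hX₁C x hx).2
    have hr := D.rel_a (ll x) x
    have hc := D.conn _ _ hx0 hr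
    refine ⟨hc.trans (D.gen_b x hx0 _ hc _), fun x' h => ?_⟩
    have hx' := hX₁inv x x' h hx
    have hr' := D.rel_a (ll x') x'
    have hrr := D.S.trans (D.S.symm hr) (D.S.trans h hr')
    have hy : D.a (ll x) x ∈ V (kk x) ∩ C := ⟨hspec x hx, (hX₁C _ (hX₁inv _ _ hr hx)).1⟩
    have hy' : D.a (ll x') x' ∈ V (kk x') ∩ C := ⟨hspec x' hx', (hX₁C _ (hX₁inv _ _ hr' hx')).1⟩
    have e : D.code (kk x) = D.code (kk x') := by
      have := hinv _ _ _ hy _ hy' hrr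
      simpa using this
    simp only [← e]
    refine ⟨trivial, ?_⟩
    have hV' : V (kk x') = V (kk x) := by simp only [V, e]
    rw [hV'] at hy'
    have := (hiff _ _ hy _ hy').1 hrr
    change _ = _ ∨ _ at this
    rcases this with h | ⟨_, _, _, _, h⟩
    · rw [h]
      exact (D.T_equiv _).refl _
    · exact h

end TreeAction

/-! ### Free products of groups -/

theorem IsFreeProductOf.induction {G : Type} [Group G] {ι : Type} {Γ : ι → Subgroup G}
    (h : IsFreeProductOf G Γ) {P : G → Prop} (of : ∀ i, ∀ γ ∈ Γ i, P γ)
    (one : P 1) (mul : ∀ g g', P g → P g' → P (g * g')) (g : G) : P g := by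
  obtain ⟨w, rfl⟩ := h.2 g
  induction w using Monoid.CoprodI.induction_on with
  | one => rwa [map_one]
  | of i γ =>
    rw [Monoid.CoprodI.lift_of]
    exact of i _ γ.2
  | mul w w' ih ih' =>
    rw [map_mul]
    exact mul _ _ ih ih'

/-- Cocycles on the orbits of the factors of a free product extend to a cocycle of the action. -/
theorem IsFreeProductOf.exists_cocycle {G : Type} [Group G] {ι : Type} {Γ : ι → Subgroup G}
    (h : IsFreeProductOf G Γ) {Y K : Type} [Group K] (act : G → Y → Y)
    (act_one : ∀ y, act 1 y = y) (act_mul : ∀ g g' y, act (g * g') y = act g (act g' y))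
    (C : ι → Y → Y → K)
    (hC : ∀ i, IsCocycleOn (fun y y' => ∃ γ ∈ Γ i, act γ y = y') (C i)) :
    ∃ d : G → Y → K, (∀ g g' y, d (g' * g) y = d g y * d g' (act g y)) ∧
      ∀ i, ∀ γ ∈ Γ i, ∀ y, d γ y = C i y (act γ y) := by
  let φ : ∀ i, Γ i →* Function.End (Y × K) := fun i =>
    { toFun := fun γ q => (act γ q.1, (C i q.1 (act γ q.1))⁻¹ * q.2)
      map_one' := by
        funext q
        have : C i q.1 q.1 = 1 := (hC i).self ⟨1, (Γ i).one_mem, act_one _⟩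
        change (act 1 q.1, (C i q.1 (act 1 q.1))⁻¹ * q.2) = q
        rw [act_one, this, inv_one, one_mul]
      map_mul' := fun γ γ' => by
        funext q
        have := hC i q.1 (act γ' q.1) (act γ (act γ' q.1)) ⟨γ', γ'.2, rfl⟩ ⟨γ, γ.2, rfl⟩
        change (act (γ * γ') q.1, (C i q.1 (act (γ * γ') q.1))⁻¹ * q.2) = (act γ (act γ' q.1),
          (C i (act γ' q.1) (act γ (act γ' q.1)))⁻¹ * ((C i q.1 (act γ' q.1))⁻¹ * q.2))
        rw [act_mul, this, mul_inv_rev, mul_assoc] }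
  let e := MulEquiv.ofBijective _ h
  let ψ : G →* Function.End (Y × K) := (Monoid.CoprodI.lift φ).comp e.symm.toMonoidHom
  have hψ : ∀ i, ∀ γ (hγ : γ ∈ Γ i), ψ γ = φ i ⟨γ, hγ⟩ := by
    intro i γ hγ
    have : e.symm γ = Monoid.CoprodI.of (M := fun i => Γ i) (i := i) ⟨γ, hγ⟩ := by
      rw [MulEquiv.symm_apply_eq]
      exact (Monoid.CoprodI.lift_of (fun i => (Γ i).subtype) (⟨γ, hγ⟩ : Γ i)).symm
    change Monoid.CoprodI.lift φ (e.symm γ) = _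
    rw [this, Monoid.CoprodI.lift_of]
  have hmul : ∀ g g' q, ψ (g * g') q = ψ g (ψ g' q) := fun g g' q => by
    rw [map_mul]
    rfl
  have hfst : ∀ g y k, ψ g (y, k) = (act g y, (ψ g (y, 1)).2 * k) := by
    intro g
    induction g using h.induction with
    | of i γ hγ =>
      intro y k
      rw [hψ i γ hγ]
      change (act γ y, (C i y (act γ y))⁻¹ * k) = (act γ y, ((C i y (act γ y))⁻¹ * 1) * k)
      rw [mul_one]
    | one =>
      intro y k
      have : ∀ q, ψ 1 q = q := fun q => by
        rw [map_one]
        rfl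
      rw [this, this, act_one, one_mul]
    | mul g g' ih ih' =>
      intro y k
      rw [hmul, hmul, ih', ih, act_mul, ih' y 1, ih (act g' y) (_ * 1), mul_one, mul_assoc]
  refine ⟨fun g y => ((ψ g (y, 1)).2)⁻¹, fun g g' y => ?_, fun i γ hγ y => ?_⟩
  · beta_reduce
    rw [hmul, hfst g y 1, hfst g', mul_one, mul_inv_rev]
  · beta_reduce
    rw [hψ i γ hγ]
    change ((C i y (act γ y))⁻¹ * 1)⁻¹ = _
    rw [mul_one, inv_inv]

/-- The factors of a free product are malnormal and pairwise non-conjugate. -/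
theorem IsFreeProductOf.malnormal {G : Type} [Group G] {ι : Type} {Γ : ι → Subgroup G}
    (h : IsFreeProductOf G Γ) {i j : ι} {γ l k : G} (hγ : γ ∈ Γ i) (hl : l ∈ Γ j)
    (hk : γ * k = k * l) (h1 : γ ≠ 1) : j = i ∧ k ∈ Γ i := by
  classical
  by_contra hcon
  have hkl : k * l * k⁻¹ ∈ Γ i := by
    rw [← hk]
    simpa using hγ
  -- the cocycle `(y, y') ↦ y * y'⁻¹` on the orbit of `k` under `Γ i`, trivial elsewhere
  obtain ⟨d, hd, hdC⟩ := h.exists_cocycle (Y := G) (K := G) (fun g y => g * y) one_mul mul_assoc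
    (fun i' y y' => if i' = i ∧ y * k⁻¹ ∈ Γ i then y * y'⁻¹ else 1) (by
      rintro i' y _ _ ⟨a, ha, rfl⟩ ⟨b, hb, rfl⟩
      by_cases hi : i' = i
      · subst hi
        have : (a * y) * k⁻¹ ∈ Γ i' ↔ y * k⁻¹ ∈ Γ i' := by
          rw [mul_assoc, (Γ i').mul_mem_cancel_left ha]
        simp only [this, true_and]
        split_ifs
        · group
        · simp
      · simp [hi])
  have hinv : ∀ g y, d g (y * l) = d g y := by
    intro g
    have hone : ∀ y, d 1 y = 1 := fun y => by
      have := hd 1 1 y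
      simpa using this
    induction g using h.induction with
    | of i' γ' hγ' =>
      intro y
      rw [hdC i' γ' hγ', hdC i' γ' hγ']
      have : y * l * k⁻¹ ∈ Γ i ↔ y * k⁻¹ ∈ Γ i := by
        have e : y * l * k⁻¹ = y * k⁻¹ * (k * l * k⁻¹) := by group
        rw [e, (Γ i).mul_mem_cancel_right hkl]
      simp only [this]
      split_ifs
      · group
      · rfl
    | one =>
      intro y
      rw [hone, hone]
    | mul g g' ih ih' =>
      intro y
      rw [hd, hd, ih', ← mul_assoc, ih]
  have e1 : d (γ * k) 1 = d k 1 * γ⁻¹ := by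
    rw [hd, hdC i γ hγ]
    simp
  have e2 : d (k * l) 1 = d k 1 := by
    rw [hd, hdC j l hl, if_neg, one_mul, mul_one]
    · simpa using hinv k 1
    · rintro ⟨rfl, h2⟩
      refine hcon ⟨rfl, ?_⟩
      simpa using h2
  rw [hk, e2] at e1
  apply h1
  simpa using e1

/-! ### Cocycles on treed equivalence relations -/

section Treeing

variable {Y K : Type} [MeasurableSpace Y] [Group K]

/-- The value in `K` of the letter `Φ i ^ e` at `y`, given the values `v` of the generators. -/
def letterValue (Φ : ℕ → PBI Y) (v : ℕ → Y → K) (i : ℕ) : Bool → Y → K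
  | true, y => v i y
  | false, y => (v i ((Φ i).invFun y))⁻¹

/-- The word `L` leads from `y` to `y'` in the graphing `Φ`, with total value `k`. -/
def WordPath (Φ : ℕ → PBI Y) (v : ℕ → Y → K) : List (ℕ × Bool) → Y → K → Y → Prop
  | [], y, k, y' => y = y' ∧ k = 1
  | a :: L, y, k, y' => ∃ y₁ k₁, PBIStep (Φ a.1) a.2 y y₁ ∧ WordPath Φ v L y₁ k₁ y' ∧
      k = letterValue Φ v a.1 a.2 y * k₁

variable {Φ : ℕ → PBI Y} {v : ℕ → Y → K}

theorem wordPath_append {L L' : List (ℕ × Bool)} : ∀ {y k y'},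
    WordPath Φ v (L ++ L') y k y' ↔
      ∃ z k₁ k₂, WordPath Φ v L y k₁ z ∧ WordPath Φ v L' z k₂ y' ∧ k = k₁ * k₂ := by
  induction L with
  | nil =>
    intro y k y'
    constructor
    · intro h
      exact ⟨y, 1, k, ⟨rfl, rfl⟩, h, (one_mul k).symm⟩
    · rintro ⟨z, k₁, k₂, ⟨rfl, rfl⟩, h, rfl⟩
      rw [one_mul]
      exact h
  | cons a L ih =>
    intro y k y'
    constructor
    · rintro ⟨y₁, k₁, hs, hp, rfl⟩
      obtain ⟨z, k₂, k₃, h2, h3, rfl⟩ := ih.1 hp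
      exact ⟨z, _, k₃, ⟨y₁, k₂, hs, h2, rfl⟩, h3, (mul_assoc _ _ _).symm⟩
    · rintro ⟨z, _, k₃, ⟨y₁, k₂, hs, h2, rfl⟩, h3, rfl⟩
      exact ⟨y₁, k₂ * k₃, hs, ih.2 ⟨z, k₂, k₃, h2, h3, rfl⟩, mul_assoc _ _ _⟩

theorem PBIStep.reverse {φ : PBI Y} {e : Bool} {y z : Y} (h : PBIStep φ e y z) :
    PBIStep φ (!e) z y := by
  cases e
  · obtain ⟨h, rfl⟩ := h
    exact ⟨φ.mapsTo_inv h, φ.right_inv _ h⟩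
  · obtain ⟨h, rfl⟩ := h
    exact ⟨φ.mapsTo h, φ.left_inv _ h⟩

theorem PBIStep.unique {φ : PBI Y} {e : Bool} {y z z' : Y} (h : PBIStep φ e y z)
    (h' : PBIStep φ e y z') : z = z' := by
  cases e
  · exact h.2.symm.trans h'.2
  · exact h.2.symm.trans h'.2

theorem letterValue_reverse {i : ℕ} {e : Bool} {y z : Y} (h : PBIStep (Φ i) e y z) :
    letterValue Φ v i (!e) z = (letterValue Φ v i e y)⁻¹ := by
  cases e
  · obtain ⟨h, rfl⟩ := h
    simp [letterValue]
  · obtain ⟨h, rfl⟩ := h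
    simp [letterValue, (Φ i).left_inv _ h]

theorem WordPath.cancel {i : ℕ} {e : Bool} {L : List (ℕ × Bool)} {y y' : Y} {k : K}
    (h : WordPath Φ v ((i, e) :: (i, !e) :: L) y k y') : WordPath Φ v L y k y' := by
  obtain ⟨z, _, hs, ⟨z', k', hs', hp, rfl⟩, rfl⟩ := h
  obtain rfl : y = z' := PBIStep.unique hs.reverse hs'
  have hv : letterValue Φ v i (!e) z = (letterValue Φ v i e y)⁻¹ := letterValue_reverse hs
  simpa [hv] using hp

theorem WordPath.reverse {L : List (ℕ × Bool)} : ∀ {y y' : Y} {k : K},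
    WordPath Φ v L y k y' → ∃ L', WordPath Φ v L' y' k⁻¹ y := by
  induction L with
  | nil =>
    rintro y _ _ ⟨rfl, rfl⟩
    exact ⟨[], rfl, inv_one⟩
  | cons a L ih =>
    rintro y y' _ ⟨z, k, hs, hp, rfl⟩
    obtain ⟨L', hL'⟩ := ih hp
    refine ⟨L' ++ [(a.1, !a.2)], wordPath_append.2 ⟨z, _, (letterValue Φ v a.1 a.2 y)⁻¹, hL',
      ⟨y, 1, hs.reverse, ⟨rfl, rfl⟩, ?_⟩, mul_inv_rev _ _⟩⟩
    rw [mul_one]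
    exact (letterValue_reverse hs).symm

/-- The vertices visited by a word path. -/
theorem WordPath.exists_vertices {L : List (ℕ × Bool)} : ∀ {y y' : Y} {k : K},
    WordPath Φ v L y k y' → ∃ x : ℕ → Y, x 0 = y ∧ x L.length = y' ∧
      ∀ j (hj : j < L.length), PBIStep (Φ L[j].1) L[j].2 (x j) (x (j + 1)) := by
  induction L with
  | nil =>
    rintro y _ _ ⟨rfl, rfl⟩
    exact ⟨fun _ => y, rfl, rfl, fun j hj => absurd hj (Nat.not_lt_zero j)⟩
  | cons a L ih =>
    rintro y y' _ ⟨z, k, hs, hp, rfl⟩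
    obtain ⟨x, h0, h1, hx⟩ := ih hp
    refine ⟨fun j => Nat.casesOn j y x, rfl, h1, fun j hj => ?_⟩
    cases j with
    | zero =>
      change PBIStep (Φ a.1) a.2 y (x 0)
      rwa [h0]
    | succ j => exact hx j (Nat.lt_of_succ_lt_succ hj)

theorem IsTreeing.closed_wordPath (hΦ : IsTreeing Φ) : ∀ (n : ℕ) {L : List (ℕ × Bool)},
    L.length ≤ n → ∀ {y : Y} {k : K}, WordPath Φ v L y k y → k = 1 := by
  intro n
  induction n with
  | zero =>
    intro L hL y k h
    obtain rfl : L = [] := List.eq_nil_of_length_eq_zero (Nat.le_zero.1 hL)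
    exact h.2
  | succ n ih =>
    intro L hL y k h
    rcases Nat.eq_zero_or_pos L.length with h0 | hpos
    · obtain rfl : L = [] := List.eq_nil_of_length_eq_zero h0
      exact h.2
    obtain ⟨x, hx0, hx1, hx⟩ := h.exists_vertices
    obtain ⟨j, hj, hi, he⟩ := hΦ L.length (fun j => (L.getD j (0, true)).1)
      (fun j => (L.getD j (0, true)).2) x hpos (hx1.trans hx0.symm) (fun j hj => by
        rw [List.getD_eq_getElem _ _ hj]
        exact hx j hj)
    have hj' : j < L.length := Nat.lt_of_succ_lt hj
    simp only [List.getD_eq_getElem _ _ hj, List.getD_eq_getElem _ _ hj'] at hi he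
    have hL' : L = L.take j ++ ((L[j].1, L[j].2) :: (L[j].1, !L[j].2) :: L.drop (j + 2)) := by
      have e : (L[j].1, !L[j].2) = L[j + 1] := by
        refine Prod.ext hi ?_
        revert he
        cases L[j].2 <;> cases L[j + 1].2 <;> simp
      rw [e, ← List.drop_eq_getElem_cons hj]
      change L = L.take j ++ (L[j] :: L.drop (j + 1))
      rw [← List.drop_eq_getElem_cons hj', List.take_append_drop]
    rw [hL'] at h
    obtain ⟨z, k₁, k₂, h1, h2, rfl⟩ := wordPath_append.1 h
    refine ih (L := L.take j ++ L.drop (j + 2)) ?_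
      (wordPath_append.2 ⟨z, k₁, k₂, h1, h2.cancel, rfl⟩)
    simp only [List.length_append, List.length_take, List.length_drop]
    omega

/-- On a treed equivalence relation, cocycles may be prescribed on the generators. -/
theorem IsTreeing.exists_cocycle {R : CBER Y} (hΦ : IsTreeing Φ) (hR : GeneratesCBER Φ R)
    (v : ℕ → Y → K) :
    ∃ c : Y → Y → K, IsCocycleOn R.rel c ∧ ∀ i, ∀ y ∈ (Φ i).src, c y ((Φ i).toFun y) = v i y := by
  have hex : ∀ y y', R.rel y y' → ∃ k L, WordPath Φ v L y k y' := by
    intro y y' h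
    replace h := ((hR.2.2 y y').1 h).2
    induction h with
    | rel y y' h =>
      obtain ⟨i, hi, rfl⟩ := h
      exact ⟨_, [(i, true)], _, 1, ⟨hi, rfl⟩, ⟨rfl, rfl⟩, rfl⟩
    | refl y => exact ⟨1, [], rfl, rfl⟩
    | symm y y' _ ih =>
      obtain ⟨k, L, h⟩ := ih
      exact ⟨_, h.reverse⟩
    | trans y y' y'' _ _ ih ih' =>
      obtain ⟨k, L, h⟩ := ih
      obtain ⟨k', L', h'⟩ := ih'
      exact ⟨k * k', L ++ L', wordPath_append.2 ⟨_, _, _, h, h', rfl⟩⟩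
  have huniq : ∀ {y y' k k' L L'}, WordPath Φ v L y k y' → WordPath Φ v L' y k' y' → k = k' := by
    intro y y' k k' L L' h h'
    obtain ⟨L'', h''⟩ := h'.reverse
    exact mul_inv_eq_one.1 (hΦ.closed_wordPath _ le_rfl
      (wordPath_append.2 ⟨_, _, _, h, h'', rfl⟩))
  choose! c hc using hex
  refine ⟨c, fun x y z hxy hyz => ?_, fun i y hy => ?_⟩
  · obtain ⟨L, h⟩ := hc x y hxy
    obtain ⟨L', h'⟩ := hc y z hyz
    obtain ⟨L'', h''⟩ := hc x z (R.trans hxy hyz)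
    exact huniq h'' (wordPath_append.2 ⟨_, _, _, h, h', rfl⟩)
  · obtain ⟨L, h⟩ := hc y ((Φ i).toFun y) ((hR.2.1 i).2 y hy)
    refine huniq h (L' := [(i, true)]) ⟨_, 1, ⟨hy, rfl⟩, ⟨rfl, rfl⟩, (mul_one _).symm⟩

theorem IsTreeing.apply_ne (hΦ : IsTreeing Φ) {i : ℕ} {y : Y} (hy : y ∈ (Φ i).src) :
    (Φ i).toFun y ≠ y := by
  intro h
  obtain ⟨j, hj, _⟩ := hΦ 1 (fun _ => i) (fun _ => true) (fun _ => y) one_pos rfl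
    (fun _ _ => ⟨hy, h⟩)
  omega

end Treeing

/-! ### Couplings of actions along an orbit equivalence of sections -/

theorem PMPAction.act_inv_act {G X : Type} [Group G] [MeasurableSpace X] {μ : Measure X}
    (α : PMPAction G X μ) (g : G) (x : X) : α.act g⁻¹ (α.act g x) = x := by
  rw [← α.act_mul, inv_mul_cancel, α.act_one]

theorem PMPAction.act_act_inv {G X : Type} [Group G] [MeasurableSpace X] {μ : Measure X}
    (α : PMPAction G X μ) (g : G) (x : X) : α.act g (α.act g⁻¹ x) = x := by
  rw [← α.act_mul, mul_inv_cancel, α.act_one]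

theorem PMPAction.measurable_act {G X : Type} [Group G] [MeasurableSpace X] {μ : Measure X}
    (α : PMPAction G X μ) (g : G) : Measurable (α.act g) :=
  (α.measurePreserving g).measurable

theorem PMPAction.eq_of_act_eq {G X : Type} [Group G] [MeasurableSpace X] {μ : Measure X}
    (α : PMPAction G X μ) {x : X} (hx : ∀ g, α.act g x = x → g = 1) {g g' : G}
    (h : α.act g x = α.act g' x) : g = g' := by
  have : α.act (g'⁻¹ * g) x = x := by rw [α.act_mul, h, α.act_inv_act]
  exact (inv_mul_eq_one.1 (hx _ this)).symm

/-- A set meeting the free orbits of an infinite subgroup at most once is null. -/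
theorem PMPAction.null_of_transversal {G X : Type} [Group G] [MeasurableSpace X]
    {μ : Measure X} [IsProbabilityMeasure μ] (α : PMPAction G X μ) (Γ : Subgroup G)
    (hΓ : Infinite Γ) {P : Set X} (hP : MeasurableSet P)
    (h : ∀ x ∈ P, ∀ γ ∈ Γ, α.act γ x ∈ P → γ = 1) : μ P = 0 := by
  obtain ⟨e⟩ : Nonempty (ℕ ↪ Γ) := ⟨Infinite.natEmbedding Γ⟩
  by_contra h0
  have hdisj : Pairwise (Function.onFun Disjoint fun k => α.act (e k) ⁻¹' P) := by
    intro i j hij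
    refine Set.disjoint_left.2 fun x hi hj => hij (e.injective (Subtype.ext ?_))
    have := h _ hi ((e j : G) * (e i : G)⁻¹) (Γ.mul_mem (e j).2 (Γ.inv_mem (e i).2)) (by
      rw [α.act_mul, α.act_inv_act]
      exact hj)
    exact (mul_inv_eq_one.1 this).symm
  have hsum := measure_iUnion (μ := μ) hdisj fun k => α.measurable_act _ hP
  simp_rw [fun k => (α.measurePreserving (e k : G)).measure_preimage hP.nullMeasurableSet] at hsum
  rw [ENNReal.tsum_const_eq_top_of_ne_zero h0] at hsum
  exact measure_ne_top _ _ hsum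

/-- An enumeration of a countable group. -/
noncomputable def groupEnum (G : Type) [Group G] [Countable G] : ℕ → G :=
  (exists_surjective_nat G).choose

theorem groupEnum_surjective (G : Type) [Group G] [Countable G] :
    Function.Surjective (groupEnum G) :=
  (exists_surjective_nat G).choose_spec

/-- An isomorphism between Borel sections of two actions which exactly preserves the orbit
relations and rescales the measure. -/
structure OrbitCoupling {G H X Y : Type} [Group G] [Group H] [MeasurableSpace X]
    [MeasurableSpace Y] {μ : Measure X} {ν : Measure Y} (α : PMPAction G X μ)
    (β : PMPAction H Y ν) where
  A : Set X
  B : Set Y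
  toFun : X → Y
  invFun : Y → X
  measA : MeasurableSet A
  measB : MeasurableSet B
  meas_toFun : Measurable toFun
  meas_invFun : Measurable invFun
  mapsTo : ∀ x ∈ A, toFun x ∈ B
  mapsTo_inv : ∀ y ∈ B, invFun y ∈ A
  left_inv : ∀ x ∈ A, invFun (toFun x) = x
  right_inv : ∀ y ∈ B, toFun (invFun y) = y
  rel_iff : ∀ x ∈ A, ∀ x' ∈ A, (∃ g, α.act g x = x') ↔ ∃ h, β.act h (toFun x) = toFun x'
  A_section : ∀ᵐ x ∂μ, ∃ g, α.act g x ∈ A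
  B_section : ∀ᵐ y ∂ν, ∃ h, β.act h y ∈ B
  A_free : ∀ x ∈ A, ∀ g, α.act g x = x → g = 1
  B_free : ∀ y ∈ B, ∀ h, β.act h y = y → h = 1
  c : ENNReal
  c_ne_zero : c ≠ 0
  c_ne_top : c ≠ ⊤
  measure_image : ∀ E, E ⊆ A → MeasurableSet E → ν (toFun '' E) = c * μ E

namespace OrbitCoupling

variable {G H X Y : Type} [Group G] [Group H] [MeasurableSpace X]
    [MeasurableSpace Y] {μ : Measure X} {ν : Measure Y} {α : PMPAction G X μ}
    {β : PMPAction H Y ν}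

/-- The inverse coupling. -/
noncomputable def symm (E : OrbitCoupling α β) : OrbitCoupling β α where
  A := E.B
  B := E.A
  toFun := E.invFun
  invFun := E.toFun
  measA := E.measB
  measB := E.measA
  meas_toFun := E.meas_invFun
  meas_invFun := E.meas_toFun
  mapsTo := E.mapsTo_inv
  mapsTo_inv := E.mapsTo
  left_inv := E.right_inv
  right_inv := E.left_inv
  rel_iff := fun y hy y' hy' => by
    rw [E.rel_iff _ (E.mapsTo_inv y hy) _ (E.mapsTo_inv y' hy'), E.right_inv y hy,
      E.right_inv y' hy']
  A_section := E.B_section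
  B_section := E.A_section
  A_free := E.B_free
  B_free := E.A_free
  c := E.c⁻¹
  c_ne_zero := ENNReal.inv_ne_zero.2 E.c_ne_top
  c_ne_top := ENNReal.inv_ne_top.2 E.c_ne_zero
  measure_image := fun F hF hm => by
    have e : E.invFun '' F = E.A ∩ E.toFun ⁻¹' F := by
      ext x
      constructor
      · rintro ⟨y, hy, rfl⟩
        exact ⟨E.mapsTo_inv y (hF hy), by rwa [Set.mem_preimage, E.right_inv y (hF hy)]⟩
      · rintro ⟨hx, hx'⟩
        exact ⟨_, hx', E.left_inv x hx⟩
    have e' : E.toFun '' (E.invFun '' F) = F := by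
      rw [Set.image_image]
      refine (Set.image_congr fun y hy => E.right_inv y (hF hy)).trans (Set.image_id' F)
    have := E.measure_image (E.invFun '' F) (by rw [e]; exact Set.inter_subset_left)
      (by rw [e]; exact E.measA.inter (E.meas_toFun hm))
    rw [e'] at this
    rw [this, ← mul_assoc, ENNReal.inv_mul_cancel E.c_ne_zero E.c_ne_top, one_mul]

/-- The saturation of the section. -/
def dom (E : OrbitCoupling α β) : Set X := {x | ∃ g, α.act g x ∈ E.A}

theorem act_mem_dom (E : OrbitCoupling α β) {x : X} (hx : x ∈ E.dom) (g : G) :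
    α.act g x ∈ E.dom := by
  obtain ⟨k, hk⟩ := hx
  refine ⟨k * g⁻¹, ?_⟩
  rwa [α.act_mul, α.act_inv_act]

theorem measure_dom_compl (E : OrbitCoupling α β) : μ E.domᶜ = 0 := E.A_section

theorem free (E : OrbitCoupling α β) {x : X} (hx : x ∈ E.dom) (g : G) (h : α.act g x = x) :
    g = 1 := by
  obtain ⟨k, hk⟩ := hx
  have := E.A_free _ hk (k * g * k⁻¹) (by
    rw [α.act_mul, α.act_mul, α.act_inv_act, h])
  simpa using this

variable [Countable G]

theorem measurableSet_dom (E : OrbitCoupling α β) : MeasurableSet E.dom := by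
  have : E.dom = ⋃ g, α.act g ⁻¹' E.A := by
    ext x
    simp [dom]
  rw [this]
  exact MeasurableSet.iUnion fun g => α.measurable_act g E.measA

/-- The index of the first translate of `x` lying in the section. -/
noncomputable def index (E : OrbitCoupling α β) (x : X) : ℕ :=
  sInf {k | α.act (groupEnum G k) x ∈ E.A}

theorem index_spec (E : OrbitCoupling α β) {x : X} (hx : x ∈ E.dom) :
    α.act (groupEnum G (E.index x)) x ∈ E.A := by
  obtain ⟨g, hg⟩ := hx
  obtain ⟨k, rfl⟩ := groupEnum_surjective G g
  exact Nat.sInf_mem (s := {k | α.act (groupEnum G k) x ∈ E.A}) ⟨k, hg⟩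

theorem measurable_index (E : OrbitCoupling α β) : Measurable E.index :=
  measurable_sInf_nat fun _ => (α.measurable_act _ E.measA).mem

/-- The extension of the coupling map to the whole space. -/
noncomputable def map (E : OrbitCoupling α β) (x : X) : Y :=
  E.toFun (α.act (groupEnum G (E.index x)) x)

theorem measurable_map (E : OrbitCoupling α β) : Measurable E.map :=
  E.meas_toFun.comp (Measurable.select_nat (fun k => α.measurable_act (groupEnum G k))
    E.measurable_index)

theorem map_mem (E : OrbitCoupling α β) {x : X} (hx : x ∈ E.dom) : E.map x ∈ E.B :=
  E.mapsTo _ (E.index_spec hx)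

theorem map_mem_dom (E : OrbitCoupling α β) {x : X} (hx : x ∈ E.dom) (h : H) :
    β.act h (E.map x) ∈ E.symm.dom :=
  E.symm.act_mem_dom ⟨1, by rw [β.act_one]; exact E.map_mem hx⟩ h

theorem exists_act_map (E : OrbitCoupling α β) {x : X} (hx : x ∈ E.dom) (g : G) :
    ∃ h, β.act h (E.map x) = E.map (α.act g x) := by
  have hx' := E.act_mem_dom hx g
  refine (E.rel_iff _ (E.index_spec hx) _ (E.index_spec hx')).1
    ⟨groupEnum G (E.index (α.act g x)) * g * (groupEnum G (E.index x))⁻¹, ?_⟩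
  rw [α.act_mul, α.act_mul, α.act_inv_act]

theorem map_injOn (E : OrbitCoupling α β) {x x' : X} (hx : x ∈ E.dom) (hx' : x' ∈ E.dom)
    (hi : E.index x = E.index x') (h : E.map x = E.map x') : x = x' := by
  have := congrArg E.invFun h
  rw [map, map, E.left_inv _ (E.index_spec hx), E.left_inv _ (E.index_spec hx'), hi] at this
  have := congrArg (α.act (groupEnum G (E.index x'))⁻¹) this
  rwa [α.act_inv_act, α.act_inv_act] at this

theorem exists_act_symm_map [Countable H] (E : OrbitCoupling α β) {x : X} (hx : x ∈ E.dom)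
    (h : H) : ∃ g, α.act g x = E.symm.map (β.act h (E.map x)) := by
  have hy := E.map_mem_dom hx h
  have hy' := E.symm.index_spec hy
  obtain ⟨g, hg⟩ := (E.rel_iff _ (E.index_spec hx) _ (E.symm.mapsTo _ hy')).2
    ⟨groupEnum H (E.symm.index (β.act h (E.map x))) * h, by
      rw [β.act_mul]
      exact (E.symm.left_inv _ hy').symm⟩
  exact ⟨g * groupEnum G (E.index x), by rw [α.act_mul]; exact hg⟩

theorem measure_preimage_null [Countable H] (E : OrbitCoupling α β) {X₁ : Set X} (h₁ : X₁ ⊆ E.dom)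
    {s : X → Y} (hs : ∀ x ∈ X₁, ∃ h, β.act h (E.map x) = s x) {N : Set Y} (hN : ν N = 0) :
    μ (X₁ ∩ s ⁻¹' N) = 0 := by
  have key : ∀ M, MeasurableSet M → ν M = 0 → μ (E.A ∩ E.toFun ⁻¹' M) = 0 := by
    intro M hM h0
    have := E.measure_image (E.A ∩ E.toFun ⁻¹' M) Set.inter_subset_left
      (E.measA.inter (E.meas_toFun hM))
    have h0' : ν (E.toFun '' (E.A ∩ E.toFun ⁻¹' M)) = 0 :=
      measure_mono_null (by rintro _ ⟨x, hx, rfl⟩; exact hx.2) h0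
    rw [h0'] at this
    exact (mul_eq_zero.1 this.symm).resolve_left E.c_ne_zero
  have hM := measurableSet_toMeasurable ν N
  have hM0 : ν (toMeasurable ν N) = 0 := by rwa [measure_toMeasurable]
  refine measure_mono_null (t := ⋃ h : H, ⋃ g : G,
    α.act g ⁻¹' (E.A ∩ E.toFun ⁻¹' (β.act h ⁻¹' toMeasurable ν N))) ?_ ?_
  · rintro x ⟨hx, hxN⟩
    obtain ⟨h, hh⟩ := hs x hx
    refine Set.mem_iUnion₂.2 ⟨h, groupEnum G (E.index x), E.index_spec (h₁ hx), ?_⟩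
    change β.act h (E.map x) ∈ toMeasurable ν N
    rw [hh]
    exact subset_toMeasurable _ _ hxN
  · refine measure_iUnion_null fun h => measure_iUnion_null fun g => ?_
    have hm := β.measurable_act h hM
    rw [(α.measurePreserving g).measure_preimage
      (E.measA.inter (E.meas_toFun hm)).nullMeasurableSet]
    refine key _ hm ?_
    rwa [(β.measurePreserving h).measure_preimage hM.nullMeasurableSet]

end OrbitCoupling

/-- A stable orbit equivalence of free actions restricts to an orbit coupling. -/
theorem SOEquiv.exists_orbitCoupling {G H X Y : Type} [Group G] [Group H] [Countable G]
    [Countable H] [MeasurableSpace X] [StandardBorelSpace X] [MeasurableSpace Y]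
    [StandardBorelSpace Y] {μ : Measure X} [IsProbabilityMeasure μ] {ν : Measure Y}
    [IsProbabilityMeasure ν] {α : PMPAction G X μ} {β : PMPAction H Y ν} (hα : α.IsFree)
    (hβ : β.IsFree) {R : CBER X} {S : CBER Y} (hR : IsOrbitRel α ⊤ R) (hS : IsOrbitRel β ⊤ S)
    (E : SOEquiv R μ S ν) : Nonempty (OrbitCoupling α β) := by
  have hfree : ∀ {G X : Type} [Group G] [Countable G] [MeasurableSpace X]
      [StandardBorelSpace X] {μ : Measure X} (α : PMPAction G X μ),
      MeasurableSet {x | ∀ g, α.act g x = x → g = 1} := by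
    intro G X _ _ _ _ μ α
    refine measurableSet_setOfPred.2 (Measurable.forall fun g => ?_)
    exact ((α.measurable_act g).eq measurable_id).imp measurable_const
  obtain ⟨C, hC, hAC, hrel⟩ := E.rel_iff
  let F : Set X := {x | ∀ g, α.act g x = x → g = 1}
  let F' : Set Y := {x | ∀ g, β.act g x = x → g = 1}
  have hF0 : μ Fᶜ = 0 := hα
  have hF'0 : ν F'ᶜ = 0 := hβ
  let A := E.A ∩ (C ∩ (F ∩ E.toFun ⁻¹' F'))
  have hA : MeasurableSet A := E.measA.inter (hC.inter ((hfree α).inter (E.meas_toFun (hfree β))))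
  let B := E.B ∩ E.invFun ⁻¹' A
  have hB : MeasurableSet B := E.measB.inter (E.meas_invFun hA)
  have hμ0 := E.A_pos.ne'
  have hν0 := E.B_pos.ne'
  have himage : ∀ D, D ⊆ E.A → MeasurableSet D → ν (E.toFun '' D) = ν E.B * (μ E.A)⁻¹ * μ D := by
    intro D hD hm
    rw [mul_assoc, E.measure_eq D hD hm, ← mul_assoc, ENNReal.mul_inv_cancel hν0
      (measure_ne_top _ _), one_mul]
  have hc0 : ν E.B * (μ E.A)⁻¹ ≠ 0 :=
    mul_ne_zero hν0 (ENNReal.inv_ne_zero.2 (measure_ne_top _ _))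
  have hN : μ (E.A \ A) = 0 := by
    refine measure_mono_null (t := (E.A \ C) ∪ (Fᶜ ∪ (E.A ∩ E.toFun ⁻¹' F'ᶜ))) ?_ ?_
    · rintro x ⟨hx, hxA⟩
      by_cases h1 : x ∈ C
      · by_cases h2 : x ∈ F
        · exact Or.inr (Or.inr ⟨hx, fun h3 => hxA ⟨hx, h1, h2, h3⟩⟩)
        · exact Or.inr (Or.inl h2)
      · exact Or.inl ⟨hx, h1⟩
    · refine measure_union_null hAC (measure_union_null hF0 ?_)
      have := himage (E.A ∩ E.toFun ⁻¹' F'ᶜ) Set.inter_subset_left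
        (E.measA.inter (E.meas_toFun (hfree β).compl))
      rw [measure_mono_null (by rintro _ ⟨x, hx, rfl⟩; exact hx.2) hF'0] at this
      exact (mul_eq_zero.1 this.symm).resolve_left hc0
  have hN' : ν (E.B \ B) = 0 := by
    have := himage (E.A \ A) Set.sdiff_subset (E.measA.diff hA)
    rw [hN, mul_zero] at this
    refine measure_mono_null ?_ this
    rintro y ⟨hy, hyB⟩
    exact ⟨E.invFun y, ⟨E.mapsTo_inv hy, fun h => hyB ⟨hy, h⟩⟩, E.right_inv y hy⟩
  have hsec : ∀ {G X : Type} [Group G] [Countable G] [MeasurableSpace X] {μ : Measure X}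
      (α : PMPAction G X μ) {R : CBER X} (_ : IsOrbitRel α ⊤ R) {A A' : Set X}
      (_ : ∀ᵐ x ∂μ, x ∈ R.dom → ∃ y ∈ A, R.rel x y) (_ : μ (A \ A') = 0),
      ∀ᵐ x ∂μ, ∃ g, α.act g x ∈ A' := by
    intro G X _ _ _ μ α R hR A A' hA h0
    have : ∀ᵐ x ∂μ, ∀ g, α.act g x ∉ A \ A' := ae_all_iff.2 fun g =>
      (α.measurePreserving g).quasiMeasurePreserving.ae (p := fun x => x ∉ A \ A')
        (measure_eq_zero_iff_ae_notMem.1 h0)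
    filter_upwards [hA, this] with x hx hx'
    obtain ⟨y, hy, hxy⟩ := hx (by rw [hR.1]; trivial)
    obtain ⟨g, -, rfl⟩ := (hR.2 _ _).1 hxy
    exact ⟨g, by_contra fun h => hx' g ⟨hy, h⟩⟩
  have hmaps : ∀ x ∈ A, E.toFun x ∈ B := fun x hx => ⟨E.mapsTo hx.1, by
    rwa [Set.mem_preimage, E.left_inv x hx.1]⟩
  refine ⟨{
    A := A
    B := B
    toFun := E.toFun
    invFun := E.invFun
    measA := hA
    measB := hB
    meas_toFun := E.meas_toFun
    meas_invFun := E.meas_invFun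
    mapsTo := hmaps
    mapsTo_inv := fun y hy => hy.2
    left_inv := fun x hx => E.left_inv x hx.1
    right_inv := fun y hy => E.right_inv y hy.1
    rel_iff := fun x hx x' hx' => ?_
    A_section := hsec α hR E.A_section hN
    B_section := hsec β hS E.B_section hN'
    A_free := fun x hx => hx.2.2.1
    B_free := fun y hy => ?_
    c := ν E.B * (μ E.A)⁻¹
    c_ne_zero := hc0
    c_ne_top := ENNReal.mul_ne_top (measure_ne_top _ _) (ENNReal.inv_ne_top.2 hμ0)
    measure_image := fun D hD hm => himage D (hD.trans Set.inter_subset_left) hm }⟩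
  · have := hrel x ⟨hx.1, hx.2.1⟩ x' ⟨hx'.1, hx'.2.1⟩
    rw [hR.2, hS.2] at this
    simpa using this
  · have := hy.2.2.2.2
    rwa [Set.mem_preimage, E.right_inv y hy.1] at this

/-! ### Actions of free products -/

/-- A p.m.p. action of a free product whose factors, apart from a treeable one, are infinite with
freely indecomposable orbit relations. -/
structure FactorAction (G X : Type) [Group G] [MeasurableSpace X] (μ : Measure X) (n : ℕ) where
  Γ : Fin n → Subgroup G
  Γ₀ : Subgroup G
  isFreeProductOf : IsFreeProductOf G (fun i : Option (Fin n) => i.elim Γ₀ Γ)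
  infinite : ∀ p, Infinite (Γ p)
  α : PMPAction G X μ
  R : Fin n → CBER X
  isOrbitRel : ∀ p, IsOrbitRel α (Γ p) (R p)
  indecomposable : ∀ p, FreelyIndecomposableMod μ (R p)
  R₀ : CBER X
  isOrbitRel_zero : IsOrbitRel α Γ₀ R₀
  Φ : ℕ → PBI X
  isTreeing : IsTreeing Φ
  generates : GeneratesCBER Φ R₀

theorem exists_separating_seq (X : Type) [MeasurableSpace X] [StandardBorelSpace X] :
    ∃ sep : ℕ → Set X, (∀ k, MeasurableSet (sep k)) ∧
      ∀ x y, x ≠ y → ∃ k, x ∈ sep k ∧ y ∉ sep k := by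
  obtain ⟨S, hS, hsep⟩ := exists_seq_separating X MeasurableSet.univ (p := MeasurableSet) Set.univ
  obtain ⟨e, he⟩ := exists_surjective_nat (ℕ × Bool)
  refine ⟨fun k => if (e k).2 then S (e k).1 else (S (e k).1)ᶜ, fun k => ?_, fun x y hxy => ?_⟩
  · beta_reduce
    split_ifs
    · exact hS _
    · exact (hS _).compl
  · by_contra hcon
    push Not at hcon
    refine hxy (hsep x trivial y trivial fun k => ?_)
    obtain ⟨l, hl⟩ := he (k, true)
    obtain ⟨l', hl'⟩ := he (k, false)
    have h1 := hcon l
    have h2 := hcon l'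
    rw [hl] at h1
    rw [hl'] at h2
    simp only [if_true, Bool.false_eq_true, if_false, Set.mem_compl_iff] at h1 h2
    exact ⟨h1, fun hy => by_contra fun hx => h2 hx hy⟩

/-- A countable separating family of Borel sets. -/
noncomputable def sepSeq (X : Type) [MeasurableSpace X] [StandardBorelSpace X] : ℕ → Set X :=
  (exists_separating_seq X).choose

theorem measurableSet_sepSeq {X : Type} [MeasurableSpace X] [StandardBorelSpace X] (k : ℕ) :
    MeasurableSet (sepSeq X k) :=
  (exists_separating_seq X).choose_spec.1 k

theorem exists_sepSeq {X : Type} [MeasurableSpace X] [StandardBorelSpace X] {x y : X}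
    (h : x ≠ y) : ∃ k, x ∈ sepSeq X k ∧ y ∉ sepSeq X k :=
  (exists_separating_seq X).choose_spec.2 x y h

namespace FactorAction

variable {G X : Type} [Group G] [MeasurableSpace X] [StandardBorelSpace X] {μ : Measure X} {n : ℕ}
    (F : FactorAction G X μ n)

/-- The part of the graph of a generator of the treeable factor on which `k` is the first index
separating a point from its image. -/
def Edge (i k : ℕ) (y y' : X) : Prop :=
  (y ∈ (F.Φ i).src ∧ (F.Φ i).toFun y = y') ∧ (y ∈ sepSeq X k ∧ y' ∉ sepSeq X k) ∧
    ∀ l < k, ¬ (y ∈ sepSeq X l ∧ y' ∉ sepSeq X l)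

/-- The pieces of the orbit relation: the orbit relations of the indecomposable factors, and
relations with at most two points in each class for the treeable factor. -/
def piece : Fin n ⊕ (ℕ × ℕ) → X → X → Prop
  | .inl q => (F.R q).rel
  | .inr a => fun y y' => y = y' ∨ F.Edge a.1 a.2 y y' ∨ F.Edge a.1 a.2 y' y

theorem measurable_piece (i : Fin n ⊕ (ℕ × ℕ)) :
    Measurable fun p : X × X => F.piece i p.1 p.2 := by
  have hE : ∀ i k, Measurable fun p : X × X => F.Edge i k p.1 p.2 := by
    intro i k
    have hs : ∀ l, Measurable fun p : X × X => p.1 ∈ sepSeq X l ∧ p.2 ∉ sepSeq X l := fun l =>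
      (measurable_fst (measurableSet_sepSeq l)).mem.and
        (measurable_snd (measurableSet_sepSeq l)).mem.not
    refine Measurable.and (Measurable.and ?_ ?_) ((hs k).and ?_)
    · exact (measurable_fst (F.Φ i).src_meas).mem
    · exact ((F.Φ i).meas_toFun.comp measurable_fst).eq measurable_snd
    · exact Measurable.forall fun l => Measurable.imp measurable_const (hs l).not
  cases i with
  | inl q => exact measurableSet_setOfPred.1 (F.R q).rel_meas
  | inr a =>
    exact (measurable_fst.eq measurable_snd).or ((hE _ _).or ((hE _ _).comp measurable_swap))

theorem piece_equivalence (i : Fin n ⊕ (ℕ × ℕ)) : Equivalence (F.piece i) := by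
  cases i with
  | inl q =>
    exact ⟨fun y => (F.R q).refl y (by rw [(F.isOrbitRel q).1]; trivial), (F.R q).symm,
      (F.R q).trans⟩
  | inr a =>
    refine ⟨fun y => Or.inl rfl, ?_, ?_⟩
    · rintro y y' (rfl | h | h)
      exacts [Or.inl rfl, Or.inr (Or.inr h), Or.inr (Or.inl h)]
    · rintro y y' y'' (rfl | h | h) (rfl | h' | h')
      · exact Or.inl rfl
      · exact Or.inr (Or.inl h')
      · exact Or.inr (Or.inr h')
      · exact Or.inr (Or.inl h)
      · exact absurd h'.2.1.1 h.2.1.2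
      · refine Or.inl ?_
        rw [← (F.Φ a.1).left_inv y h.1.1, ← (F.Φ a.1).left_inv y'' h'.1.1, h.1.2, h'.1.2]
      · exact Or.inr (Or.inr h)
      · exact Or.inl (h.1.2.symm.trans h'.1.2)
      · exact absurd h.2.1.1 h'.2.1.2

theorem eq_of_piece_inr {a : ℕ × ℕ} {y y' : X}
    (h : F.piece (.inr a) y y') (hs : y ∈ sepSeq X a.2 ↔ y' ∈ sepSeq X a.2) : y = y' := by
  rcases h with h | h | h
  · exact h
  · exact absurd (hs.1 h.2.1.1) h.2.1.2
  · exact absurd (hs.2 h.2.1.1) h.2.1.2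

theorem Edge.exists_act {F : FactorAction G X μ n} {i k : ℕ} {y y' : X} (h : F.Edge i k y y') :
    ∃ g ∈ F.Γ₀, F.α.act g y = y' := by
  obtain ⟨⟨hy, rfl⟩, -⟩ := h
  exact (F.isOrbitRel_zero.2 _ _).1 ((F.generates.2.1 i).2 y hy)

theorem exists_act_of_gen {y y' : X} (h : GenBy F.piece y y') : ∃ g, F.α.act g y = y' := by
  have hsymm : ∀ {y y'}, (∃ g, F.α.act g y = y') → ∃ g, F.α.act g y' = y := by
    rintro y _ ⟨g, rfl⟩
    exact ⟨g⁻¹, F.α.act_inv_act g y⟩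
  induction h with
  | rel y y' h =>
    obtain ⟨i | a, h⟩ := h
    · obtain ⟨g, -, hg⟩ := ((F.isOrbitRel i).2 _ _).1 h
      exact ⟨g, hg⟩
    · rcases h with rfl | h | h
      · exact ⟨1, F.α.act_one _⟩
      · exact h.exists_act.imp fun g hg => hg.2
      · exact hsymm (h.exists_act.imp fun g hg => hg.2)
  | refl y => exact ⟨1, F.α.act_one _⟩
  | symm y y' _ ih => exact hsymm ih
  | trans y y' y'' _ _ ih ih' =>
    obtain ⟨g, rfl⟩ := ih
    obtain ⟨g', rfl⟩ := ih'
    exact ⟨g' * g, F.α.act_mul _ _ _⟩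

theorem exists_edge {i : ℕ} {y : X} (hy : y ∈ (F.Φ i).src) :
    F.Edge i (sInf {k | y ∈ sepSeq X k ∧ (F.Φ i).toFun y ∉ sepSeq X k}) y ((F.Φ i).toFun y) := by
  refine ⟨⟨hy, rfl⟩, ?_, fun l hl => Nat.notMem_of_lt_sInf hl⟩
  exact Nat.sInf_mem (s := {k | y ∈ sepSeq X k ∧ (F.Φ i).toFun y ∉ sepSeq X k})
    (exists_sepSeq (F.isTreeing.apply_ne hy).symm)

theorem Edge.eq_sInf {F : FactorAction G X μ n} {i k : ℕ} {y y' : X} (h : F.Edge i k y y') :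
    sInf {k | y ∈ sepSeq X k ∧ (F.Φ i).toFun y ∉ sepSeq X k} = k := by
  obtain ⟨⟨hy, rfl⟩, hk, hl⟩ := h
  refine le_antisymm (Nat.sInf_le hk) ?_
  by_contra hcon
  exact hl _ (not_le.1 hcon) (F.exists_edge hy).2.1

theorem gen_act (g : G) : ∀ y, GenBy F.piece y (F.α.act g y) := by
  induction g using F.isFreeProductOf.induction with
  | of i γ hγ =>
    intro y
    cases i with
    | some p => exact GenBy.of (T := F.piece) (i := Sum.inl p) (((F.isOrbitRel p).2 _ _).2 ⟨γ, hγ, rfl⟩)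
    | none =>
      have h := ((F.generates.2.2 _ _).1 ((F.isOrbitRel_zero.2 y _).2 ⟨γ, hγ, rfl⟩)).2
      generalize F.α.act γ y = y' at h
      induction h with
      | rel y y' h =>
        obtain ⟨i, hi, rfl⟩ := h
        exact GenBy.of (T := F.piece) (i := Sum.inr (i, _)) (Or.inr (Or.inl (F.exists_edge hi)))
      | refl y => exact GenBy.rfl
      | symm y y' _ ih => exact ih.symm
      | trans y y' y'' _ _ ih ih' => exact ih.trans ih'
  | one =>
    intro y
    rw [F.α.act_one]
    exact GenBy.rfl
  | mul g g' ih ih' =>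
    intro y
    rw [F.α.act_mul]
    exact (ih' y).trans (ih _)

theorem gen_iff {y y' : X} : GenBy F.piece y y' ↔ ∃ g, F.α.act g y = y' :=
  ⟨F.exists_act_of_gen, by rintro ⟨g, rfl⟩; exact F.gen_act g y⟩

/-- Cocycles on the pieces extend to every free orbit. -/
theorem exists_cocycle (K : Type) [Group K] (C : Fin n ⊕ (ℕ × ℕ) → X → X → K)
    (hC : ∀ i, IsCocycleOn (F.piece i) (C i)) {y₀ : X} (hy₀ : ∀ g, F.α.act g y₀ = y₀ → g = 1) :
    ∃ c : X → X → K,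
      (∀ y y' y'', GenBy F.piece y₀ y → GenBy F.piece y₀ y' → GenBy F.piece y₀ y'' →
        c y y'' = c y y' * c y' y'') ∧
      ∀ i y y', GenBy F.piece y₀ y → F.piece i y y' → c y y' = C i y y' := by
  classical
  obtain ⟨c₀, hc₀, hv⟩ := F.isTreeing.exists_cocycle F.generates (K := K) fun i y =>
    C (.inr (i, sInf {k | y ∈ sepSeq X k ∧ (F.Φ i).toFun y ∉ sepSeq X k})) y ((F.Φ i).toFun y)
  obtain ⟨d, hd, hdC⟩ := F.isFreeProductOf.exists_cocycle F.α.act F.α.act_one F.α.act_mul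
    (fun i => i.elim c₀ fun q => C (.inl q)) (by
      rintro (_ | q) x y z hxy hyz
      · exact hc₀ x y z ((F.isOrbitRel_zero.2 _ _).2 hxy) ((F.isOrbitRel_zero.2 _ _).2 hyz)
      · exact hC (.inl q) x y z (((F.isOrbitRel q).2 _ _).2 hxy)
          (((F.isOrbitRel q).2 _ _).2 hyz))
  let c : X → X → K := fun y y' => if h : ∃ g, F.α.act g y = y' then d h.choose y else 1
  have hfree : ∀ y, GenBy F.piece y₀ y → ∀ g, F.α.act g y = y → g = 1 := by
    intro y hy g hg
    obtain ⟨k, rfl⟩ := F.gen_iff.1 hy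
    have := hy₀ (k⁻¹ * g * k) (by rw [F.α.act_mul, F.α.act_mul, hg, F.α.act_inv_act])
    have h2 := congrArg (fun t => k * t * k⁻¹) this
    simpa [mul_assoc] using h2
  have hcd : ∀ y, GenBy F.piece y₀ y → ∀ g, c y (F.α.act g y) = d g y := by
    intro y hy g
    have h : ∃ g', F.α.act g' y = F.α.act g y := ⟨g, rfl⟩
    change (if h : ∃ g', F.α.act g' y = F.α.act g y then d h.choose y else 1) = _
    rw [dif_pos h, F.α.eq_of_act_eq (hfree y hy) h.choose_spec]
  have hmul : ∀ y y' y'', GenBy F.piece y₀ y → GenBy F.piece y₀ y' → GenBy F.piece y₀ y'' →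
      c y y'' = c y y' * c y' y'' := by
    intro y y' y'' hy hy' hy''
    obtain ⟨g, rfl⟩ := F.gen_iff.1 (hy.symm.trans hy')
    obtain ⟨g', rfl⟩ := F.gen_iff.1 (hy'.symm.trans hy'')
    rw [hcd y hy, hcd _ hy', ← F.α.act_mul, hcd y hy, hd]
  have hedge : ∀ i k y y', GenBy F.piece y₀ y → F.Edge i k y y' →
      c y y' = C (.inr (i, k)) y y' := by
    intro i k y y' hy h
    obtain ⟨g, hg, rfl⟩ := h.exists_act
    rw [hcd y hy, hdC none g hg, ← h.1.2]
    have := hv i y h.1.1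
    rw [h.eq_sInf] at this
    exact this
  refine ⟨c, hmul, ?_⟩
  rintro (q | a) y y' hy h
  · obtain ⟨g, hg, rfl⟩ := ((F.isOrbitRel q).2 _ _).1 h
    rw [hcd y hy, hdC (some q) g hg]
    rfl
  · have hy' : GenBy F.piece y₀ y' := hy.trans (GenBy.of (i := .inr a) h)
    have hself : ∀ y, GenBy F.piece y₀ y → c y y = 1 := fun y hy => by
      simpa using hmul y y y hy hy hy
    rcases h with rfl | h | h
    · rw [hself y hy, (hC (.inr a)).self (Or.inl rfl)]
    · exact hedge _ _ _ _ hy h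
    · have h1 := hmul y y' y hy hy' hy
      have h2 := hC (.inr a) y y' y (Or.inr (Or.inr h)) (Or.inr (Or.inl h))
      rw [(hC (.inr a)).self (Or.inl rfl)] at h2
      rw [hself y hy, hedge _ _ _ _ hy' h, h2] at h1
      exact (mul_right_cancel h1).symm

end FactorAction

namespace FactorAction

variable {G H X Y : Type} [Group G] [Group H] [Countable G] [Countable H] [MeasurableSpace X]
    [StandardBorelSpace X] [MeasurableSpace Y] [StandardBorelSpace Y] {μ : Measure X}
    {ν : Measure Y} {n m : ℕ}

/-- The orbit relation of an indecomposable factor, mapped by a coupling into the orbits of the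
other action. -/
noncomputable def treeAction (F : FactorAction G X μ n) (F' : FactorAction H Y ν m)
    (E : OrbitCoupling F.α F'.α) (p : Fin n) : TreeAction X Y (Fin m ⊕ (ℕ × ℕ)) where
  S := F.R p
  dom_univ := (F.isOrbitRel p).1
  a k := F.α.act (groupEnum (F.Γ p) k)
  a_meas k := F.α.measurable_act _
  a_inj k := Function.LeftInverse.injective (F.α.act_inv_act _)
  S_iff x y := by
    rw [(F.isOrbitRel p).2]
    constructor
    · rintro ⟨g, hg, rfl⟩
      obtain ⟨k, hk⟩ := groupEnum_surjective (F.Γ p) ⟨g, hg⟩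
      exact ⟨k, by rw [hk]⟩
    · rintro ⟨k, rfl⟩
      exact ⟨_, (groupEnum (F.Γ p) k).2, rfl⟩
  sep := sepSeq X
  sep_meas := measurableSet_sepSeq
  sep_spec _ _ := exists_sepSeq
  X₀ := E.dom
  X₀_meas := E.measurableSet_dom
  X₀_inv x y h hx := by
    obtain ⟨g, -, rfl⟩ := ((F.isOrbitRel p).2 _ _).1 h
    exact E.act_mem_dom hx g
  f := E.map
  f_meas := E.measurable_map
  κ := E.index
  κ_meas := E.measurable_index
  f_inj x y hx h hf hκ := by
    obtain ⟨g, -, rfl⟩ := ((F.isOrbitRel p).2 _ _).1 h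
    exact E.map_injOn hx (E.act_mem_dom hx g) hκ hf
  b k := F'.α.act (groupEnum H k)
  b_meas k := F'.α.measurable_act _
  T := F'.piece
  T_meas := F'.measurable_piece
  T_equiv := F'.piece_equivalence
  code := (exists_surjective_nat ((Fin m ⊕ (ℕ × ℕ)) × ℕ)).choose
  code_surj := (exists_surjective_nat ((Fin m ⊕ (ℕ × ℕ)) × ℕ)).choose_spec
  b_of_gen y y' h := by
    obtain ⟨g, rfl⟩ := F'.gen_iff.1 h
    obtain ⟨k, rfl⟩ := groupEnum_surjective H g
    exact ⟨k, rfl⟩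
  gen_b _ _ y _ k := F'.gen_act _ y
  conn x y hx h := by
    obtain ⟨g, -, rfl⟩ := ((F.isOrbitRel p).2 _ _).1 h
    exact F'.gen_iff.2 (E.exists_act_map hx g)
  ext K _ C hC x hx := F'.exists_cocycle K C hC (E.B_free _ (E.map_mem hx))

/-- `q` and `s` define, on the conull invariant set `X₁`, a homomorphism of the orbit relation of
the factor `p` to those of the indecomposable factors of the other action. -/
structure IsFactorHom (F : FactorAction G X μ n) (F' : FactorAction H Y ν m)
    (E : OrbitCoupling F.α F'.α) (p : Fin n) (X₁ : Set X) (q : X → Fin m) (s : X → Y) : Prop where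
  meas_dom : MeasurableSet X₁
  null_compl : μ X₁ᶜ = 0
  subset_dom : X₁ ⊆ E.dom
  invariant : ∀ x ∈ X₁, ∀ x', (F.R p).rel x x' → x' ∈ X₁
  meas_q : ∀ j, MeasurableSet {x | q x = j}
  meas_s : Measurable s
  exists_act : ∀ x ∈ X₁, ∃ h, F'.α.act h (E.map x) = s x
  hom : ∀ x ∈ X₁, ∀ x', (F.R p).rel x x' → q x = q x' ∧ (F'.R (q x)).rel (s x) (s x')

theorem exists_isFactorHom [IsProbabilityMeasure μ] (F : FactorAction G X μ n)
    (F' : FactorAction H Y ν m) (E : OrbitCoupling F.α F'.α) (p : Fin n) :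
    ∃ X₁ q s, IsFactorHom F F' E p X₁ q s := by
  obtain ⟨X₁, hm₁, h₁, hsub, hinv, i, s, hi, hs, hhom⟩ := (F.treeAction F' E p).exists_vertex μ
    (F.indecomposable p) E.measure_dom_compl
    (fun k => (F.α.measurePreserving _).quasiMeasurePreserving) (by
      intro P hP htr
      refine measure_mono_null (t := (P ∩ E.dom) ∪ E.domᶜ) ?_ (measure_union_null
        (F.α.null_of_transversal (F.Γ p) (F.infinite p) (hP.inter E.measurableSet_dom) ?_)
        E.measure_dom_compl)
      · intro x hx
        by_cases h : x ∈ E.dom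
        exacts [Or.inl ⟨hx, h⟩, Or.inr h]
      · intro x hx γ hγ hx'
        exact E.free hx.2 γ (htr x hx.1 _ hx'.1 (((F.isOrbitRel p).2 _ _).2 ⟨γ, hγ, rfl⟩)).symm)
  have hsub' : X₁ ⊆ E.dom := hsub
  have hact : ∀ x ∈ X₁, ∃ h, F'.α.act h (E.map x) = s x := fun x hx =>
    F'.gen_iff.1 (hhom x hx).1
  let N : Set X := ⋃ a : ℕ × ℕ, {x | i x = .inr a}
  have hN : MeasurableSet N := MeasurableSet.iUnion fun a => hi _
  have hN0 : μ (X₁ ∩ N) = 0 := by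
    let P : ℕ × ℕ → Prop → ℕ → H → Set X := fun a σ k h =>
      {x | ((x ∈ X₁ ∧ i x = .inr a) ∧ (s x ∈ sepSeq Y a.2 ↔ σ)) ∧
        E.index x = k ∧ F'.α.act h (E.map x) = s x}
    refine measure_mono_null (t := ⋃ a : ℕ × ℕ, ⋃ k : ℕ, ⋃ h : H, P a True k h ∪ P a False k h)
      ?_ (measure_iUnion_null fun a => measure_iUnion_null fun k => measure_iUnion_null fun h =>
        ?_)
    · rintro x ⟨hx, hxN⟩
      obtain ⟨a, ha⟩ := Set.mem_iUnion.1 hxN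
      obtain ⟨h, hh⟩ := hact x hx
      refine Set.mem_iUnion.2 ⟨a, Set.mem_iUnion₂.2 ⟨E.index x, h, ?_⟩⟩
      by_cases hsep : s x ∈ sepSeq Y a.2
      · exact Or.inl ⟨⟨⟨hx, ha⟩, iff_true_intro hsep⟩, rfl, hh⟩
      · exact Or.inr ⟨⟨⟨hx, ha⟩, iff_false_intro hsep⟩, rfl, hh⟩
    · have key : ∀ σ, μ (P a σ k h) = 0 := by
        intro σ
        refine F.α.null_of_transversal (F.Γ p) (F.infinite p) ?_ ?_
        · refine measurableSet_setOfPred.2 (Measurable.and (Measurable.and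
            (hm₁.mem.and (measurableSet_setOfPred.1 (hi _)))
            ((hs (measurableSet_sepSeq _)).mem.iff measurable_const)) (Measurable.and
            (E.measurable_index.eq measurable_const)
            (((F'.α.measurable_act h).comp E.measurable_map).eq hs)))
        · rintro x ⟨⟨⟨hx, hix⟩, hsx⟩, hkx, hhx⟩ γ hγ ⟨⟨⟨hx', hix'⟩, hsx'⟩, hkx', hhx'⟩
          have h1 := ((hhom x hx).2 (F.α.act γ x)
            (((F.isOrbitRel p).2 _ _).2 ⟨γ, hγ, rfl⟩)).2
          rw [hix] at h1
          have h2 : s x = s (F.α.act γ x) := F'.eq_of_piece_inr h1 (hsx.trans hsx'.symm)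
          rw [← hhx, ← hhx'] at h2
          have h3 := congrArg (F'.α.act h⁻¹) h2
          rw [F'.α.act_inv_act, F'.α.act_inv_act] at h3
          exact E.free (hsub' hx) γ
            (E.map_injOn (hsub' hx) (hsub' hx') (hkx.trans hkx'.symm) h3).symm
      exact measure_union_null (key _) (key _)
  have hnull : μ (X₁ \ N)ᶜ = 0 := by
    refine measure_mono_null (t := X₁ᶜ ∪ (X₁ ∩ N)) ?_ (measure_union_null h₁ hN0)
    intro x hx
    by_cases h : x ∈ X₁
    · exact Or.inr ⟨h, by_contra fun h' => hx ⟨h, h'⟩⟩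
    · exact Or.inl h
  have hinl : ∀ x ∈ X₁ \ N, ∃ j, i x = .inl j := by
    intro x hx
    rcases h : i x with j | a
    · exact ⟨j, rfl⟩
    · exact absurd (Set.mem_iUnion.2 ⟨a, h⟩) hx.2
  obtain ⟨j₀⟩ : Nonempty (Fin m) := by
    by_contra hne
    have : X₁ \ N = ∅ := Set.eq_empty_of_forall_notMem fun x hx =>
      hne ⟨(hinl x hx).choose⟩
    rw [this, Set.compl_empty, measure_univ] at hnull
    exact one_ne_zero hnull
  have hq : ∀ x ∈ X₁ \ N, i x = .inl (Sum.elim id (fun _ => j₀) (i x)) := by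
    intro x hx
    obtain ⟨j, hj⟩ := hinl x hx
    rw [hj]
    rfl
  refine ⟨X₁ \ N, fun x => Sum.elim id (fun _ => j₀) (i x), s, hm₁.diff hN, hnull,
    Set.sdiff_subset.trans hsub', ?_, fun j => ?_, hs, fun x hx => hact x hx.1, ?_⟩
  · intro x hx x' hxx'
    refine ⟨hinv x x' hxx' hx.1, fun hN' => hx.2 ?_⟩
    obtain ⟨a, ha⟩ := Set.mem_iUnion.1 hN'
    refine Set.mem_iUnion.2 ⟨a, ?_⟩
    change i x = _
    rw [((hhom x hx.1).2 x' hxx').1]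
    exact ha
  · have : {x | Sum.elim id (fun _ => j₀) (i x) = j} =
        ⋃ t : {t : Fin m ⊕ (ℕ × ℕ) // Sum.elim id (fun _ => j₀) t = j}, {x | i x = t} := by
      ext x
      simp
    rw [this]
    exact MeasurableSet.iUnion fun t => hi _
  · intro x hx x' hxx'
    have h := (hhom x hx.1).2 x' hxx'
    refine ⟨by rw [h.1], ?_⟩
    have h2 := h.2
    rw [hq x hx] at h2
    exact h2

end FactorAction

namespace FactorAction

variable {G H X Y : Type} [Group G] [Group H] [Countable G] [Countable H] [MeasurableSpace X]
    [StandardBorelSpace X] [MeasurableSpace Y] [StandardBorelSpace Y] {μ : Measure X}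
    {ν : Measure Y} {n m : ℕ}

/-- A homomorphism of the orbit relation of an indecomposable factor to those of the factors,
which moves points inside the orbits of the free action, is inner. -/
theorem ae_eq_of_hom [IsProbabilityMeasure μ] (F : FactorAction G X μ n) (p : Fin n)
    {X₁ : Set X} (hm : MeasurableSet X₁) (h₁ : μ X₁ᶜ = 0)
    (hfree : ∀ x ∈ X₁, ∀ g, F.α.act g x = x → g = 1) {j : X → Fin n} {u : X → X}
    (hj : Measurable j) (hu : Measurable u) (hact : ∀ x ∈ X₁, ∃ g, F.α.act g x = u x)
    (hhom : ∀ x ∈ X₁, ∀ x', (F.R p).rel x x' → j x = j x' ∧ (F.R (j x)).rel (u x) (u x')) :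
    ∀ᵐ x ∂μ, j x = p ∧ (F.R p).rel x (u x) := by
  let P : {a : Fin n × G // ¬ (a.1 = p ∧ a.2 ∈ F.Γ p)} → Set X := fun a =>
    {x | (x ∈ X₁ ∧ j x = a.1.1) ∧ F.α.act a.1.2 x = u x}
  have hP : μ (X₁ᶜ ∪ ⋃ a, P a) = 0 := by
    refine measure_union_null h₁ (measure_iUnion_null ?_)
    rintro ⟨⟨i, g⟩, ha⟩
    refine F.α.null_of_transversal (F.Γ p) (F.infinite p) ?_ ?_
    · exact measurableSet_setOfPred.2 (Measurable.and (hm.mem.and (hj.eq measurable_const))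
        ((F.α.measurable_act g).eq hu))
    · rintro x ⟨⟨hx, hjx⟩, hgx⟩ γ hγ ⟨-, hgx'⟩
      have h := (hhom x hx (F.α.act γ x) (((F.isOrbitRel p).2 _ _).2 ⟨γ, hγ, rfl⟩)).2
      rw [hjx, ← hgx, ← hgx'] at h
      obtain ⟨l, hl, hlx⟩ := ((F.isOrbitRel i).2 _ _).1 h
      rw [← F.α.act_mul, ← F.α.act_mul] at hlx
      have hmul : l * g = g * γ := F.α.eq_of_act_eq (hfree x hx) hlx
      by_contra hne
      have := F.isFreeProductOf.malnormal (i := some p) (j := some i) (γ := γ) (l := l)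
        (k := g⁻¹) hγ hl (by rw [eq_inv_mul_iff_mul_eq, ← mul_assoc, ← hmul, mul_assoc,
          mul_inv_cancel, mul_one]) hne
      exact ha ⟨Option.some.inj this.1, (F.Γ p).inv_mem_iff.1 this.2⟩
  refine measure_mono_null ?_ hP
  intro x hx
  by_cases h : x ∈ X₁
  · obtain ⟨g, hg⟩ := hact x h
    refine Or.inr (Set.mem_iUnion.2 ⟨⟨(j x, g), fun ha => hx ?_⟩, ⟨h, rfl⟩, hg⟩)
    exact ⟨ha.1, ((F.isOrbitRel p).2 _ _).2 ⟨g, ha.2, hg⟩⟩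
  · exact Or.inl h

namespace IsFactorHom

set_option linter.unusedSectionVars false

variable {F : FactorAction G X μ n} {F' : FactorAction H Y ν m} {E : OrbitCoupling F.α F'.α}
    {p : Fin n} {X₁ : Set X} {q : X → Fin m} {s : X → Y}

theorem symm_symm (h : IsFactorHom F F' E p X₁ q s) : IsFactorHom F F' E.symm.symm p X₁ q s :=
  ⟨h.meas_dom, h.null_compl, h.subset_dom, h.invariant, h.meas_q, h.meas_s, h.exists_act, h.hom⟩

theorem ae_mem (h : IsFactorHom F F' E p X₁ q s) : ∀ᵐ x ∂μ, x ∈ X₁ := h.null_compl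

theorem measurable_q (h : IsFactorHom F F' E p X₁ q s) : Measurable q :=
  measurable_to_countable' h.meas_q

theorem ae_comp (h : IsFactorHom F F' E p X₁ q s) {P : Y → Prop} (hP : ∀ᵐ y ∂ν, P y) :
    ∀ᵐ x ∂μ, P (s x) := by
  have h0 : ∀ᵐ x ∂μ, x ∉ X₁ ∩ s ⁻¹' {y | ¬ P y} := measure_eq_zero_iff_ae_notMem.1
    (E.measure_preimage_null h.subset_dom h.exists_act hP)
  filter_upwards [h0, h.ae_mem] with x hx hx₁
  by_contra hPx
  exact hx ⟨hx₁, hPx⟩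

/-- The composition of factor homomorphisms in both directions is inner. -/
theorem round_trip [IsProbabilityMeasure μ] (h : IsFactorHom F F' E p X₁ q s)
    {Y₁ : Fin m → Set Y} {r : Fin m → Y → Fin n} {t : Fin m → Y → X}
    (h' : ∀ j, IsFactorHom F' F E.symm j (Y₁ j) (r j) (t j)) :
    ∀ᵐ x ∂μ, r (q x) (s x) = p ∧ (F.R p).rel x (t (q x) (s x)) := by
  have hpair : Measurable fun x => (q x, s x) := h.measurable_q.prodMk h.meas_s
  have hY₁ : Measurable fun x => s x ∈ Y₁ (q x) :=
    (measurable_from_prod_countable_right (f := fun z : Fin m × Y => z.2 ∈ Y₁ z.1)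
      fun j => (h' j).meas_dom.mem).comp hpair
  refine F.ae_eq_of_hom p (X₁ := {x | x ∈ X₁ ∧ s x ∈ Y₁ (q x)})
    (j := fun x => r (q x) (s x)) (u := fun x => t (q x) (s x))
    (measurableSet_setOfPred.2 (h.meas_dom.mem.and hY₁)) ?_ (fun x hx => E.free (h.subset_dom hx.1))
    ((measurable_from_prod_countable_right (f := fun z : Fin m × Y => r z.1 z.2)
      fun j => (h' j).measurable_q).comp hpair)
    ((measurable_from_prod_countable_right (f := fun z : Fin m × Y => t z.1 z.2)
      fun j => (h' j).meas_s).comp hpair) ?_ ?_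
  · have : ∀ᵐ x ∂μ, x ∈ X₁ ∧ s x ∈ Y₁ (q x) := by
      filter_upwards [h.ae_mem, h.ae_comp (ae_all_iff.2 fun j => (h' j).ae_mem)] with x hx hx'
      exact ⟨hx, hx' _⟩
    exact this
  · rintro x ⟨hx, hx'⟩
    obtain ⟨g, hg⟩ := (h' (q x)).exists_act _ hx'
    obtain ⟨k, hk⟩ := h.exists_act x hx
    obtain ⟨g', hg'⟩ := E.exists_act_symm_map (h.subset_dom hx) k
    refine ⟨g * g', ?_⟩
    rw [F.α.act_mul, hg', hk, hg]
  · rintro x ⟨hx, hx'⟩ x' hxx'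
    obtain ⟨hq, hs⟩ := h.hom x hx x' hxx'
    rw [← hq]
    exact (h' (q x)).hom _ hx' _ hs

end IsFactorHom

end FactorAction

/-- A non-null Borel set is a section of an ergodic orbit relation, up to null sets. -/
theorem ErgodicCBER.ae_exists_rel {G X : Type} [Group G] [Countable G] [MeasurableSpace X]
    {μ : Measure X} {α : PMPAction G X μ} {Γ : Subgroup G} {R : CBER X}
    (hR : ErgodicCBER R μ) (hΓ : IsOrbitRel α Γ R) {A : Set X} (hA : MeasurableSet A)
    (h0 : μ A ≠ 0) : ∀ᵐ x ∂μ, x ∈ R.dom → ∃ y ∈ A, R.rel x y := by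
  have hsat : MeasurableSet {x | ∃ y ∈ A, R.rel x y} := by
    have : {x | ∃ y ∈ A, R.rel x y} = ⋃ γ : Γ, α.act γ ⁻¹' A := by
      ext x
      simp only [hΓ.2, Set.mem_iUnion, Set.mem_preimage]
      constructor
      · rintro ⟨_, hy, γ, hγ, rfl⟩
        exact ⟨⟨γ, hγ⟩, hy⟩
      · rintro ⟨γ, hγ⟩
        exact ⟨_, hγ, γ, γ.2, rfl⟩
    rw [this]
    exact MeasurableSet.iUnion fun γ => α.measurable_act _ hA
  rcases hR _ hsat (by
    rintro x ⟨y, hy, hxy⟩ z hxz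
    exact ⟨y, hy, R.trans (R.symm hxz) hxy⟩) with h | h
  · refine absurd (measure_mono_null (s := A) ?_ h) h0
    exact fun x hx => ⟨x, hx, R.refl x (by rw [hΓ.1]; trivial)⟩
  · have h' : ∀ᵐ x ∂μ, ∃ y ∈ A, R.rel x y := h
    filter_upwards [h'] with x hx _
    exact hx

/-- A measurable map to a finite set which is invariant on a conull invariant set is constant. -/
theorem ErgodicCBER.ae_eq_const {X : Type} [MeasurableSpace X] {μ : Measure X}
    [IsProbabilityMeasure μ] {R : CBER X} (hR : ErgodicCBER R μ) {m : ℕ} {q : X → Fin m}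
    (hq : Measurable q) {X₁ : Set X} (hm : MeasurableSet X₁) (h₁ : μ X₁ᶜ = 0)
    (hinv : ∀ x ∈ X₁, ∀ x', R.rel x x' → x' ∈ X₁ ∧ q x = q x') : ∃ j, ∀ᵐ x ∂μ, q x = j := by
  by_contra hcon
  have hcon := not_exists.1 hcon
  have hnull : ∀ j, μ {x | x ∈ X₁ ∧ q x = j} = 0 := by
    intro j
    refine (hR {x | x ∈ X₁ ∧ q x = j} (measurableSet_setOfPred.2 (hm.mem.and
      (hq.eq measurable_const))) ?_).resolve_right fun h => ?_
    · rintro x ⟨hx, rfl⟩ x' hxx'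
      exact ⟨(hinv x hx x' hxx').1, (hinv x hx x' hxx').2.symm⟩
    · refine hcon j (measure_mono_null ?_ h)
      intro x hx hx'
      exact hx hx'.2
  have : μ Set.univ = 0 := by
    refine measure_mono_null (t := X₁ᶜ ∪ ⋃ j, {x | x ∈ X₁ ∧ q x = j}) ?_
      (measure_union_null h₁ (measure_iUnion_null hnull))
    intro x _
    by_cases hx : x ∈ X₁
    · exact Or.inr (Set.mem_iUnion.2 ⟨q x, hx, rfl⟩)
    · exact Or.inl hx
  rw [measure_univ] at this
  exact one_ne_zero this

theorem PMPAction.image_act {G X : Type} [Group G] [MeasurableSpace X] {μ : Measure X}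
    (α : PMPAction G X μ) (g : G) (D : Set X) : α.act g '' D = α.act g⁻¹ ⁻¹' D := by
  ext x
  constructor
  · rintro ⟨y, hy, rfl⟩
    rwa [Set.mem_preimage, α.act_inv_act]
  · intro hx
    exact ⟨_, hx, α.act_act_inv g x⟩

theorem PMPAction.measurableSet_image_act {G X : Type} [Group G] [MeasurableSpace X]
    {μ : Measure X} (α : PMPAction G X μ) (g : G) {D : Set X} (hD : MeasurableSet D) :
    MeasurableSet (α.act g '' D) := by
  rw [α.image_act]
  exact α.measurable_act _ hD

theorem PMPAction.measure_image_act {G X : Type} [Group G] [MeasurableSpace X]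
    {μ : Measure X} (α : PMPAction G X μ) (g : G) {D : Set X} (hD : MeasurableSet D) :
    μ (α.act g '' D) = μ D := by
  rw [α.image_act]
  exact (α.measurePreserving _).measure_preimage hD.nullMeasurableSet

theorem OrbitCoupling.measurableSet_image {G H X Y : Type} [Group G] [Group H]
    [MeasurableSpace X] [MeasurableSpace Y] {μ : Measure X} {ν : Measure Y}
    {α : PMPAction G X μ} {β : PMPAction H Y ν} (E : OrbitCoupling α β) {D : Set X}
    (hD : D ⊆ E.A) (hm : MeasurableSet D) : MeasurableSet (E.toFun '' D) := by
  have : E.toFun '' D = E.B ∩ E.invFun ⁻¹' D := by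
    ext y
    constructor
    · rintro ⟨x, hx, rfl⟩
      exact ⟨E.mapsTo x (hD hx), by rwa [Set.mem_preimage, E.left_inv x (hD hx)]⟩
    · rintro ⟨hy, hy'⟩
      exact ⟨_, hy', E.right_inv y hy⟩
  rw [this]
  exact E.measB.inter (E.meas_invFun hm)

/-- A map which agrees with a translate of a coupling on a non-null set, and which there preserves
two ergodic relations, gives a stable orbit equivalence. -/
theorem OrbitCoupling.soe_of_translate {G H X Y : Type} [Group G] [Group H] [Countable G]
    [Countable H] [MeasurableSpace X] [MeasurableSpace Y] {μ : Measure X}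
    [IsProbabilityMeasure μ] {ν : Measure Y} [IsProbabilityMeasure ν] {α : PMPAction G X μ}
    {β : PMPAction H Y ν} (E : OrbitCoupling α β) {Γ : Subgroup G} {Λ : Subgroup H} {R : CBER X}
    {S : CBER Y} (hR : IsOrbitRel α Γ R) (hS : IsOrbitRel β Λ S) (hRe : ErgodicCBER R μ)
    (hSe : ErgodicCBER S ν) (g : G) (h : H) {A : Set X} (hA : MeasurableSet A) (hA0 : μ A ≠ 0)
    (hsub : ∀ x ∈ A, α.act g x ∈ E.A)
    (hrel : ∀ x ∈ A, ∀ x' ∈ A, R.rel x x' ↔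
      S.rel (β.act h (E.toFun (α.act g x))) (β.act h (E.toFun (α.act g x')))) :
    SOE R μ S ν := by
  let φ : X → Y := fun x => β.act h (E.toFun (α.act g x))
  let ψ : Y → X := fun y => α.act g⁻¹ (E.invFun (β.act h⁻¹ y))
  have himage : ∀ D, φ '' D = β.act h '' (E.toFun '' (α.act g '' D)) := fun D => by
    rw [Set.image_image, Set.image_image]
  have hψφ : ∀ x ∈ A, ψ (φ x) = x := fun x hx => by
    change α.act g⁻¹ (E.invFun (β.act h⁻¹ (β.act h (E.toFun (α.act g x))))) = x
    rw [β.act_inv_act, E.left_inv _ (hsub x hx), α.act_inv_act]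
  have hsub' : ∀ D, D ⊆ A → α.act g '' D ⊆ E.A := by
    rintro D hD _ ⟨x, hx, rfl⟩
    exact hsub x (hD hx)
  have hmeas : ∀ D, D ⊆ A → MeasurableSet D → ν (φ '' D) = E.c * μ D := by
    intro D hD hm
    have hm' := α.measurableSet_image_act g hm
    rw [himage, β.measure_image_act h (E.measurableSet_image (hsub' D hD) hm'),
      E.measure_image _ (hsub' D hD) hm', α.measure_image_act g hm]
  have hB : MeasurableSet (φ '' A) := by
    rw [himage]
    exact β.measurableSet_image_act h
      (E.measurableSet_image (hsub' A subset_rfl) (α.measurableSet_image_act g hA))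
  have hB0 : ν (φ '' A) ≠ 0 := by
    rw [hmeas A subset_rfl hA]
    exact mul_ne_zero E.c_ne_zero hA0
  refine ⟨{
    A := A
    B := φ '' A
    toFun := φ
    invFun := ψ
    measA := hA
    measB := hB
    A_sub := by rw [hR.1]; exact Set.subset_univ _
    B_sub := by rw [hS.1]; exact Set.subset_univ _
    A_pos := pos_iff_ne_zero.2 hA0
    B_pos := pos_iff_ne_zero.2 hB0
    A_section := hRe.ae_exists_rel hR hA hA0
    B_section := hSe.ae_exists_rel hS hB hB0
    meas_toFun := (β.measurable_act h).comp (E.meas_toFun.comp (α.measurable_act g))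
    meas_invFun := (α.measurable_act _).comp (E.meas_invFun.comp (β.measurable_act _))
    mapsTo := fun x hx => ⟨x, hx, rfl⟩
    mapsTo_inv := ?_
    left_inv := hψφ
    right_inv := ?_
    measure_eq := fun D hD hm => ?_
    rel_iff := ⟨Set.univ, MeasurableSet.univ, by simp, fun x hx y hy => hrel x hx.1 y hy.1⟩ }⟩
  · rintro _ ⟨x, hx, rfl⟩
    rwa [hψφ x hx]
  · rintro _ ⟨x, hx, rfl⟩
    rw [hψφ x hx]
  · rw [hmeas A subset_rfl hA, hmeas D hD hm,
      ENNReal.mul_inv (Or.inl E.c_ne_zero) (Or.inl E.c_ne_top), mul_mul_mul_comm,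
      ENNReal.inv_mul_cancel E.c_ne_zero E.c_ne_top, one_mul]

namespace FactorAction

variable {G H X Y : Type} [Group G] [Group H] [Countable G] [Countable H] [MeasurableSpace X]
    [StandardBorelSpace X] [MeasurableSpace Y] [StandardBorelSpace Y] {μ : Measure X}
    [IsProbabilityMeasure μ] {ν : Measure Y} [IsProbabilityMeasure ν] {n m : ℕ}

theorem IsFactorHom.soe {F : FactorAction G X μ n} {F' : FactorAction H Y ν m}
    {E : OrbitCoupling F.α F'.α} {p : Fin n} {X₁ : Set X} {q : X → Fin m} {s : X → Y}
    (h : IsFactorHom F F' E p X₁ q s) {j : Fin m} {Y₁ : Set Y} {r : Y → Fin n} {t : Y → X}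
    (h' : IsFactorHom F' F E.symm j Y₁ r t) (hq : ∀ᵐ x ∂μ, q x = j)
    (hrt : ∀ᵐ x ∂μ, r (s x) = p ∧ (F.R p).rel x (t (s x))) (he : ErgodicCBER (F.R p) μ)
    (he' : ErgodicCBER (F'.R j) ν) : SOE (F.R p) μ (F'.R j) ν := by
  let good : Set X := {x | (x ∈ X₁ ∧ s x ∈ Y₁) ∧ q x = j ∧ r (s x) = p ∧ (F.R p).rel x (t (s x))}
  have hgood : μ goodᶜ = 0 := by
    have : ∀ᵐ x ∂μ, x ∈ good := by
      filter_upwards [h.ae_mem, h.ae_comp h'.ae_mem, hq, hrt] with x h1 h2 h3 h4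
      exact ⟨⟨h1, h2⟩, h3, h4⟩
    exact this
  let W : Set X := (toMeasurable μ goodᶜ)ᶜ
  have hW : MeasurableSet W := (measurableSet_toMeasurable _ _).compl
  have hWg : W ⊆ good := Set.compl_subset_comm.1 (subset_toMeasurable _ _)
  have hW0 : μ Wᶜ = 0 := by rwa [compl_compl, measure_toMeasurable]
  let P : ℕ × H → Set X := fun a =>
    {x | x ∈ W ∧ E.index x = a.1 ∧ F'.α.act a.2 (E.map x) = s x}
  obtain ⟨⟨k, b⟩, hP⟩ : ∃ a, μ (P a) ≠ 0 := by
    by_contra hcon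
    push Not at hcon
    have : μ Set.univ = 0 := by
      refine measure_mono_null (t := Wᶜ ∪ ⋃ a, P a) ?_
        (measure_union_null hW0 (measure_iUnion_null hcon))
      intro x _
      by_cases hx : x ∈ W
      · obtain ⟨b, hb⟩ := h.exists_act x (hWg hx).1.1
        exact Or.inr (Set.mem_iUnion.2 ⟨(E.index x, b), hx, rfl, hb⟩)
      · exact Or.inl hx
    rw [measure_univ] at this
    exact one_ne_zero this
  have hPm : MeasurableSet (P (k, b)) := measurableSet_setOfPred.2 (hW.mem.and
    ((E.measurable_index.eq measurable_const).and
      (((F'.α.measurable_act b).comp E.measurable_map).eq h.meas_s)))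
  have hs : ∀ x ∈ P (k, b), F'.α.act b (E.toFun (F.α.act (groupEnum G k) x)) = s x := by
    rintro x ⟨-, rfl, hx⟩
    exact hx
  refine E.soe_of_translate (F.isOrbitRel p) (F'.isOrbitRel j) he he' (groupEnum G k) b hPm hP
    ?_ fun x hx x' hx' => ?_
  · rintro x ⟨hx, rfl, -⟩
    exact E.index_spec (h.subset_dom (hWg hx).1.1)
  · rw [hs x hx, hs x' hx']
    obtain ⟨⟨hx₁, hy₁⟩, rfl, rfl, hxt⟩ := hWg hx.1
    obtain ⟨-, -, hr', hxt'⟩ := hWg hx'.1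
    refine ⟨fun hxx' => (h.hom x hx₁ x' hxx').2, fun hss => ?_⟩
    exact (F.R _).trans hxt ((F.R _).trans (h'.hom _ hy₁ _ hss).2 ((F.R _).symm hxt'))

theorem ergodic_and_soe (F : FactorAction G X μ n) (F' : FactorAction H Y ν m)
    (E : OrbitCoupling F.α F'.α) (hnm : n ≤ m) (herg : ∀ p, ErgodicCBER (F.R p) μ) :
    (∀ q, ErgodicCBER (F'.R q) ν) ∧ n = m ∧
      ∃ θ : Fin n ≃ Fin m, ∀ p, SOE (F.R p) μ (F'.R (θ p)) ν := by
  choose X₁ q s h using F.exists_isFactorHom F' E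
  choose Y₁ r t h' using F'.exists_isFactorHom F E.symm
  have hX := fun p => (h p).round_trip h'
  have hY := fun j => (h' j).round_trip fun p => (h p).symm_symm
  choose θ hθ using fun p => (herg p).ae_eq_const (h p).measurable_q (h p).meas_dom
    (h p).null_compl fun x hx x' hxx' => ⟨(h p).invariant x hx x' hxx', ((h p).hom x hx x' hxx').1⟩
  have hr : ∀ j, ∀ᵐ y ∂ν, θ (r j y) = j := by
    intro j
    filter_upwards [hY j, (h' j).ae_comp (ae_all_iff.2 hθ)] with y hy hy'
    rw [← hy' (r j y)]
    exact hy.1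
  have hsurj : Function.Surjective θ := by
    intro j
    obtain ⟨y, hy⟩ := (hr j).exists
    exact ⟨_, hy⟩
  obtain rfl : n = m := le_antisymm hnm (by simpa using Fintype.card_le_of_surjective θ hsurj)
  have hinj : Function.Injective θ := Finite.injective_iff_surjective.2 hsurj
  have herg' : ∀ j, ErgodicCBER (F'.R j) ν := by
    intro j A hA hinv
    obtain ⟨p, rfl⟩ := hsurj j
    have hmem : ∀ᵐ y ∂ν, (y ∈ A ↔ t (θ p) y ∈ {x | x ∈ X₁ p ∧ q p x = θ p ∧ s p x ∈ A}) := by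
      filter_upwards [hY (θ p), hr (θ p), (h' (θ p)).ae_comp (h p).ae_mem] with y hy hy' hy''
      have hp : r (θ p) y = p := hinj hy'
      rw [hp] at hy
      exact ⟨fun h => ⟨hy'', hy.1, hinv y h _ hy.2⟩,
        fun h => hinv _ h.2.2 _ ((F'.R _).symm hy.2)⟩
    rcases herg p {x | x ∈ X₁ p ∧ q p x = θ p ∧ s p x ∈ A} (measurableSet_setOfPred.2
        ((h p).meas_dom.mem.and (((h p).measurable_q.eq measurable_const).and
          ((h p).meas_s hA).mem))) (by
      rintro x ⟨hx, hq, hs⟩ x' hxx'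
      have hh := (h p).hom x hx x' hxx'
      refine ⟨(h p).invariant x hx x' hxx', hh.1.symm.trans hq, hinv _ hs _ ?_⟩
      rw [← hq]
      exact hh.2) with h0 | h0
    · left
      refine measure_eq_zero_iff_ae_notMem.2 ?_
      filter_upwards [hmem, (h' (θ p)).ae_comp (measure_eq_zero_iff_ae_notMem.1 h0)] with y hy hy'
      exact fun hyA => hy' (hy.1 hyA)
    · right
      have : ∀ᵐ y ∂ν, y ∈ A := by
        filter_upwards [hmem, (h' (θ p)).ae_comp (P := fun x =>
          x ∈ {x | x ∈ X₁ p ∧ q p x = θ p ∧ s p x ∈ A}) h0] with y hy hy'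
        exact hy.2 hy'
      exact this
  refine ⟨herg', rfl, Equiv.ofBijective θ ⟨hinj, hsurj⟩, fun p => ?_⟩
  refine (h p).soe (h' (θ p)) (hθ p) ?_ (herg p) (herg' _)
  filter_upwards [hX p, hθ p] with x hx hx'
  rwa [hx'] at hx

end FactorAction

/-- In the Framework with finitely many factors, `n ≤ m`, if all the
restrictions `α|Γ_p` are ergodic then all the restrictions `β|Λ_q` are ergodic, `n = m`,
and the factors are in bijective SOE correspondence. -/
theorem SOE_BassSerre_ergodic_one_side
    {X Y : Type} [MeasurableSpace X] [StandardBorelSpace X]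
    [MeasurableSpace Y] [StandardBorelSpace Y]
    (μ : MeasureTheory.Measure X) [MeasureTheory.IsProbabilityMeasure μ]
    (ν : MeasureTheory.Measure Y) [MeasureTheory.IsProbabilityMeasure ν]
    {G H : Type} [Group G] [Countable G] [Group H] [Countable H]
    {n m : ℕ} (hn : 1 ≤ n) (hnm : n ≤ m)
    (Γ : Fin n → Subgroup G) (Γ₀ : Subgroup G) (Λ : Fin m → Subgroup H) (Λ₀ : Subgroup H)
    (hG : IsFreeProductOf G (fun i : Option (Fin n) => i.elim Γ₀ Γ))
    (hH : IsFreeProductOf H (fun j : Option (Fin m) => j.elim Λ₀ Λ))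
    (hΓinf : ∀ p, Infinite (Γ p)) (hΛinf : ∀ q, Infinite (Λ q))
    (α : PMPAction G X μ) (β : PMPAction H Y ν)
    (hαfree : α.IsFree) (hβfree : β.IsFree)
    (Rα : CBER X) (Rβ : CBER Y)
    (hRα : IsOrbitRel α ⊤ Rα) (hRβ : IsOrbitRel β ⊤ Rβ)
    (RΓ : Fin n → CBER X) (RΛ : Fin m → CBER Y) (RΓ₀ : CBER X) (RΛ₀ : CBER Y)
    (hRΓ : ∀ p, IsOrbitRel α (Γ p) (RΓ p)) (hRΛ : ∀ q, IsOrbitRel β (Λ q) (RΛ q))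
    (hRΓ₀ : IsOrbitRel α Γ₀ RΓ₀) (hRΛ₀ : IsOrbitRel β Λ₀ RΛ₀)
    (hFIΓ : ∀ p, FreelyIndecomposableMod μ (RΓ p))
    (hFIΛ : ∀ q, FreelyIndecomposableMod ν (RΛ q))
    (hTΓ₀ : RΓ₀.Treeable) (hTΛ₀ : RΛ₀.Treeable)
    (hsoe : SOE Rα μ Rβ ν)
    (hergΓ : ∀ p, ErgodicCBER (RΓ p) μ) :
    (∀ q, ErgodicCBER (RΛ q) ν) ∧ n = m ∧
      ∃ θ : Fin n ≃ Fin m, ∀ p, SOE (RΓ p) μ (RΛ (θ p)) ν := by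
  obtain ⟨Φ, hΦ, hΦR⟩ := hTΓ₀
  obtain ⟨Ψ, hΨ, hΨR⟩ := hTΛ₀
  obtain ⟨E⟩ := hsoe
  obtain ⟨E⟩ := E.exists_orbitCoupling hαfree hβfree hRα hRβ
  let F : FactorAction G X μ n :=
    ⟨Γ, Γ₀, hG, hΓinf, α, RΓ, hRΓ, hFIΓ, RΓ₀, hRΓ₀, Φ, hΦ, hΦR⟩
  let F' : FactorAction H Y ν m :=
    ⟨Λ, Λ₀, hH, hΛinf, β, RΛ, hRΛ, hFIΛ, RΛ₀, hRΛ₀, Ψ, hΨ, hΨR⟩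
  exact F.ergodic_and_soe F' E hnm hergΓ
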